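/- arXiv:2502.16004 — 3 statements merged into one kernel-verified Lean document; each statement's English description precedes it below -/
import Mathlib

section
/- A commutative Noetherian local ring R is Gorenstein if and only if there exists a nonzero finitely generated R-module M with both finite injective dimension and finite projective dimension. -/
/-!
STATEMENT 0: A commutative Noetherian local ring `R` is Gorenstein (i.e. `R` has finite
injective dimension as a module over itself) if and only if there exists a nonzero finitely
generated `R`-module `M` with both finite injective dimension and finite projective dimension.
-/

open CategoryTheory

/-- `Ext^n_R(M, N)` as an `R`-module, via the derived functor `Ext` of Mathlib. -/
noncomputable def extRMod (R : Type) [CommRing R] (M N : ModuleCat R) (n : ℕ) : ModuleCat R :=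
  ((Ext R (ModuleCat R) n).obj (Opposite.op M)).obj N

/-- Vanishing of `Ext^n_R(M, N)`. -/
def extVanish (R : Type) [CommRing R] (M N : ModuleCat R) (n : ℕ) : Prop :=
  Subsingleton (extRMod R M N n)

/-- `M` has injective dimension at most `n`: `Ext^i(N, M) = 0` for every module `N` and
every `i > n`. -/
def injDimLE (R : Type) [CommRing R] (M : ModuleCat R) (n : ℕ) : Prop :=
  ∀ (N : ModuleCat R) (i : ℕ), n < i → extVanish R N M i

/-- `M` has projective dimension at most `n`: `Ext^i(M, N) = 0` for every module `N` and
every `i > n`. -/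
def projDimLE (R : Type) [CommRing R] (M : ModuleCat R) (n : ℕ) : Prop :=
  ∀ (N : ModuleCat R) (i : ℕ), n < i → extVanish R M N i

/-- A commutative Noetherian local ring is Gorenstein if it has finite injective dimension
as a module over itself. -/
def IsGorensteinRing (R : Type) [CommRing R] : Prop :=
  ∃ n : ℕ, injDimLE R (ModuleCat.of R R) n

open Limits in
theorem extVanish_iff_subsingleton_ext (R : Type) [CommRing R] (X M : ModuleCat R) (n : ℕ) :
    extVanish R X M (n + 1) ↔ Subsingleton (Abelian.Ext X M (n + 1)) := by
  let P := projectiveResolution X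
  have key : extVanish R X M (n + 1) ↔ ∀ f : P.complex.X (n + 1) ⟶ M,
      P.complex.d (n + 2) (n + 1) ≫ f = 0 → ∃ g, P.complex.d (n + 1) n ≫ g = f := by
    unfold extVanish extRMod
    rw [← ModuleCat.isZero_iff_subsingleton, (P.isoExt (R := R) (n + 1) M).isZero_iff,
      ← HomologicalComplex.exactAt_iff_isZero_homology,
      HomologicalComplex.exactAt_iff' _ n (n + 1) (n + 2) (by simp) (by simp),
      ShortComplex.moduleCat_exact_iff]
    rfl
  rw [key]
  constructor
  · intro h
    refine subsingleton_of_forall_eq 0 fun x => ?_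
    obtain ⟨f, hf, rfl⟩ := P.extMk_surjective x (n + 2) rfl
    rw [P.extMk_eq_zero_iff f (n + 2) rfl hf n rfl]
    exact h f hf
  · intro h f hf
    exact (P.extMk_eq_zero_iff f (n + 2) rfl hf n rfl).1 (Subsingleton.elim _ _)

theorem ModuleCat.shortExact_of_linearMap {R : Type} [CommRing R] {A B C : Type}
    [AddCommGroup A] [Module R A] [AddCommGroup B] [Module R B] [AddCommGroup C] [Module R C]
    (f : A →ₗ[R] B) (g : B →ₗ[R] C) (hf : Function.Injective f) (hg : Function.Surjective g)
    (h : Function.Exact f g) :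
    (ShortComplex.mk (ModuleCat.ofHom f) (ModuleCat.ofHom g)
      (by ext x; exact h.apply_apply_eq_zero x)).ShortExact where
  exact := by
    rw [ShortComplex.moduleCat_exact_iff]
    exact fun x hx => (h x).1 hx
  mono_f := (ModuleCat.mono_iff_injective _).2 hf
  epi_g := (ModuleCat.epi_iff_surjective _).2 hg

open IsLocalRing in
/-- If `Ext^i(k, Y)` vanishes in all degrees above `n`, then so does `Ext^i(R ⧸ I, Y)`
for every ideal `I`. -/
theorem subsingleton_ext_quotient_of_residueField {R : Type} [CommRing R] [IsNoetherianRing R]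
    [IsLocalRing R] (Y : ModuleCat R) [Module.Finite R Y] (n : ℕ)
    (h : ∀ i, n < i →
      Subsingleton (Abelian.Ext (ModuleCat.of R (R ⧸ maximalIdeal R)) Y i))
    (I : Ideal R) :
    ∀ i, n < i → Subsingleton (Abelian.Ext (ModuleCat.of R (R ⧸ I)) Y i) := by
  induction I using IsNoetherian.induction with
  | hgt I ih =>
  intro i hi
  by_cases hI : I = ⊤
  · subst hI
    refine subsingleton_of_forall_eq 0 fun e => ?_
    have : Limits.IsZero (ModuleCat.of R (R ⧸ (⊤ : Ideal R))) := by
      rw [ModuleCat.isZero_iff_subsingleton]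
      exact Ideal.Quotient.subsingleton_iff.2 rfl
    have := this.hasProjectiveDimensionLT_zero
    exact e.eq_zero_of_hasProjectiveDimensionLT 0 (Nat.zero_le _)
  by_cases hm : maximalIdeal R ≤ I
  · rw [← (maximalIdeal.isMaximal R).eq_of_le hI hm]
    exact h i hi
  obtain ⟨x, hxm, hxI⟩ := SetLike.not_le_iff_exists.1 hm
  let f : R →ₗ[R] R ⧸ I := x • Submodule.mkQ I
  have hIJ : I ≤ LinearMap.ker f := fun y hy => by
    have : Submodule.mkQ I y = 0 := (Submodule.Quotient.mk_eq_zero I).2 hy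
    simp only [LinearMap.mem_ker, f, LinearMap.smul_apply, this, smul_zero]
  have hIx : I ≤ I ⊔ Ideal.span {x} := le_sup_left
  have hlt : I < I ⊔ Ideal.span {x} := lt_of_le_of_ne hIx fun he =>
    hxI (he ▸ Ideal.mem_sup_right (Ideal.mem_span_singleton_self x))
  have hvan := ih _ hlt
  obtain ⟨J, hJ⟩ : ∃ J, J = LinearMap.ker f := ⟨_, rfl⟩
  have hS := ModuleCat.shortExact_of_linearMap (J.liftQ f hJ.le)
    (Submodule.factor hIx) (LinearMap.ker_eq_bot.1 (Submodule.ker_liftQ_eq_bot' _ _ hJ))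
    (Submodule.factor_surjective hIx) (fun z => by
      obtain ⟨r, rfl⟩ := Submodule.Quotient.mk_surjective _ z
      have hr : Submodule.factor hIx (Submodule.Quotient.mk r) = 0 ↔
          r ∈ I ⊔ Ideal.span {x} := Submodule.Quotient.mk_eq_zero _
      rw [hr, Submodule.mem_sup]
      constructor
      · rintro ⟨y, hy, w, hw, rfl⟩
        obtain ⟨b, rfl⟩ := Ideal.mem_span_singleton'.1 hw
        refine ⟨Submodule.Quotient.mk b, ?_⟩
        change Submodule.Quotient.mk (x • b) = _
        rw [Submodule.Quotient.eq]
        simpa [mul_comm x b] using I.neg_mem hy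
      · rintro ⟨w, hw⟩
        obtain ⟨b, rfl⟩ := Submodule.Quotient.mk_surjective _ w
        change Submodule.Quotient.mk (x • b) = _ at hw
        rw [Submodule.Quotient.eq] at hw
        exact ⟨_, I.neg_mem hw, x * b, Ideal.mem_span_singleton'.2 ⟨b, mul_comm _ _⟩, by
          simp⟩)
  rw [← hJ] at hIJ
  obtain rfl | hlt' := hIJ.eq_or_lt
  · have hmul : I.liftQ f hJ.le = x • LinearMap.id := by
      ext
      rfl
    have hsurj : ∀ e : Abelian.Ext (ModuleCat.of R (R ⧸ I)) Y i,
        ∃ e' : Abelian.Ext (ModuleCat.of R (R ⧸ I)) Y i, x • e' = e := fun e => by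
      have := hvan (i + 1) (by lia)
      obtain ⟨e', he'⟩ := Abelian.Ext.contravariant_sequence_exact₁ hS Y e (add_comm 1 i)
        (Subsingleton.elim _ _)
      refine ⟨e', ?_⟩
      rw [← he']
      have : ModuleCat.ofHom (I.liftQ f hJ.le) = x • 𝟙 (ModuleCat.of R (R ⧸ I)) := by
        rw [hmul]
        rfl
      change _ = (Abelian.Ext.mk₀ (ModuleCat.ofHom (I.liftQ f hJ.le))).comp e' _
      rw [this, Abelian.Ext.mk₀_smul, Abelian.Ext.smul_comp, Abelian.Ext.mk₀_id_comp]
    have hbot : (⊤ : Submodule R (Abelian.Ext (ModuleCat.of R (R ⧸ I)) Y i)) = ⊥ := by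
      refine Submodule.eq_bot_of_le_smul_of_le_jacobson_bot (maximalIdeal R) _
        Module.Finite.fg_top (fun e _ => ?_) (maximalIdeal_le_jacobson _)
      obtain ⟨e', rfl⟩ := hsurj e
      exact Submodule.smul_mem_smul hxm trivial
    exact Submodule.subsingleton_iff R |>.1 (subsingleton_of_bot_eq_top hbot.symm)
  · have h1 := ih _ hlt' i hi
    have h3 := hvan i hi
    refine subsingleton_of_forall_eq 0 fun e => ?_
    obtain ⟨e', he'⟩ := Abelian.Ext.contravariant_sequence_exact₂ hS Y e (Subsingleton.elim _ _)
    rw [← he', Subsingleton.elim e' 0, Abelian.Ext.comp_zero]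

theorem subsingleton_ext_iff_of_shortExact_of_injective {R : Type} [CommRing R]
    {S : ShortComplex (ModuleCat R)} (hS : S.ShortExact) [Injective S.X₂]
    (X : ModuleCat R) (a : ℕ) :
    Subsingleton (Abelian.Ext X S.X₃ (a + 1)) ↔ Subsingleton (Abelian.Ext X S.X₁ (a + 2)) := by
  constructor
  · intro h
    refine subsingleton_of_forall_eq 0 fun e => ?_
    obtain ⟨e', he'⟩ := Abelian.Ext.covariant_sequence_exact₁ X hS e
      (Abelian.Ext.eq_zero_of_injective _) rfl
    rw [← he', Subsingleton.elim e' 0, Abelian.Ext.zero_comp]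
  · intro h
    refine subsingleton_of_forall_eq 0 fun e => ?_
    obtain ⟨e', he'⟩ := Abelian.Ext.covariant_sequence_exact₃ X hS e rfl (Subsingleton.elim _ _)
    rw [← he', Abelian.Ext.eq_zero_of_injective e', Abelian.Ext.zero_comp]

/-- If every element killed by `I` lifts to an element killed by `I` along
`S.X₂ ⟶ S.X₃`, where `S.X₂` is injective, then `Ext^1(R ⧸ I, S.X₁) = 0`. -/
theorem subsingleton_ext_one_quotient_of_lifts {R : Type} [CommRing R] (I : Ideal R)
    {S : ShortComplex (ModuleCat R)} (hS : S.ShortExact) [Injective S.X₂]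
    (h : ∀ w : S.X₃, (∀ r ∈ I, r • w = 0) → ∃ y : S.X₂, (∀ r ∈ I, r • y = 0) ∧ S.g y = w) :
    Subsingleton (Abelian.Ext (ModuleCat.of R (R ⧸ I)) S.X₁ 1) := by
  refine subsingleton_of_forall_eq 0 fun e => ?_
  obtain ⟨e', rfl⟩ := Abelian.Ext.covariant_sequence_exact₁ _ hS e
    (Abelian.Ext.eq_zero_of_injective _) (zero_add 1)
  obtain ⟨φ, rfl⟩ := Abelian.Ext.homEquiv₀.symm.surjective e'
  obtain ⟨y, hy, hyw⟩ := h (φ (Submodule.Quotient.mk (1 : R))) (fun r hr => by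
    rw [← map_smul, ← Submodule.Quotient.mk_smul, smul_eq_mul, mul_one,
      (Submodule.Quotient.mk_eq_zero I).2 hr, map_zero])
  let ψ : ModuleCat.of R (R ⧸ I) ⟶ S.X₂ := ModuleCat.ofHom
    (I.liftQ (LinearMap.toSpanSingleton R S.X₂ y) fun r hr => hy r hr)
  have hψ : ψ ≫ S.g = φ := by
    ext
    change S.g ((1 : R) • y) = _
    rw [one_smul, hyw]
    rfl
  rw [← hψ, Abelian.Ext.homEquiv₀_symm_apply, ← Abelian.Ext.mk₀_comp_mk₀,
    Abelian.Ext.comp_assoc_of_second_deg_zero, hS.comp_extClass, Abelian.Ext.comp_zero]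

theorem ModuleCat.injective_of_subsingleton_ext_one_quotient {R : Type} [CommRing R]
    (K : ModuleCat R)
    (h : ∀ J : Ideal R, Subsingleton (Abelian.Ext (ModuleCat.of R (R ⧸ J)) K 1)) :
    Injective K := by
  have hB : Module.Baer R K := fun J g => by
    have hS := ModuleCat.shortExact_of_linearMap J.subtype J.mkQ J.subtype_injective
      J.mkQ_surjective (LinearMap.exact_subtype_mkQ J)
    have := h J
    obtain ⟨e, he⟩ := Abelian.Ext.contravariant_sequence_exact₁ hS K
      (Abelian.Ext.mk₀ (ModuleCat.ofHom g)) (add_zero 1) (Subsingleton.elim _ _)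
    obtain ⟨φ, rfl⟩ := Abelian.Ext.homEquiv₀.symm.surjective e
    rw [Abelian.Ext.homEquiv₀_symm_apply, Abelian.Ext.mk₀_comp_mk₀] at he
    have he' := Abelian.Ext.homEquiv₀.symm.injective he
    refine ⟨φ.hom, fun x hx => ?_⟩
    exact LinearMap.congr_fun (congr_arg ModuleCat.Hom.hom he') ⟨x, hx⟩
  have := hB.injective
  exact Module.injective_object_of_injective_module R K

/-- The `i`-th cosyzygy of a module. -/
noncomputable def ModuleCat.cosyzygy {R : Type} [CommRing R] (N : ModuleCat R) :
    ℕ → ModuleCat R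
  | 0 => N
  | i + 1 => Limits.cokernel (Injective.ι (ModuleCat.cosyzygy N i))

/-- The short exact sequence embedding a cosyzygy in an injective module, with cokernel the next
cosyzygy. -/
noncomputable abbrev ModuleCat.cosyzygySequence {R : Type} [CommRing R] (N : ModuleCat R)
    (i : ℕ) : ShortComplex (ModuleCat R) :=
  ShortComplex.mk (X₁ := N.cosyzygy i) (X₂ := Injective.under (N.cosyzygy i))
    (X₃ := N.cosyzygy (i + 1)) (Injective.ι (N.cosyzygy i))
    (Limits.cokernel.π (Injective.ι (N.cosyzygy i))) (Limits.cokernel.condition _)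

theorem ModuleCat.shortExact_cosyzygySequence {R : Type} [CommRing R] (N : ModuleCat R)
    (i : ℕ) : (N.cosyzygySequence i).ShortExact where
  exact := ShortComplex.exact_cokernel _
  mono_f := inferInstanceAs (Mono (Injective.ι _))
  epi_g := inferInstanceAs (Epi (Limits.cokernel.π _))

theorem ModuleCat.subsingleton_ext_cosyzygy_iff {R : Type} [CommRing R] (N X : ModuleCat R)
    (i a : ℕ) : Subsingleton (Abelian.Ext X (N.cosyzygy i) (a + 1)) ↔
      Subsingleton (Abelian.Ext X N (a + i + 1)) := by
  induction i generalizing a with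
  | zero => rfl
  | succ i ih =>
    have hI : Injective (N.cosyzygySequence i).X₂ :=
      inferInstanceAs (Injective (Injective.under _))
    refine (subsingleton_ext_iff_of_shortExact_of_injective
      (N.shortExact_cosyzygySequence i) X a).trans ((ih (a + 1)).trans ?_)
    rw [show a + (i + 1) + 1 = a + 1 + i + 1 by lia]

theorem ModuleCat.hasInjectiveDimensionLT_cosyzygy_iff {R : Type} [CommRing R]
    (N : ModuleCat R) (i n : ℕ) : HasInjectiveDimensionLT (N.cosyzygy i) (n + 1) ↔
      HasInjectiveDimensionLT N (n + i + 1) := by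
  induction i generalizing n with
  | zero => rfl
  | succ i ih =>
    have hI : Injective (N.cosyzygySequence i).X₂ :=
      inferInstanceAs (Injective (Injective.under _))
    refine ((N.shortExact_cosyzygySequence i).hasInjectiveDimensionLT_X₃_iff n hI).trans
      ((ih (n + 1)).trans ?_)
    rw [show n + (i + 1) + 1 = n + 1 + i + 1 by lia]

theorem hasInjectiveDimensionLT_of_cosyzygy_lifts {R : Type} [CommRing R] [IsNoetherianRing R]
    [IsLocalRing R] (N : ModuleCat R) [Module.Finite R N] (n : ℕ)
    (h : ∀ i, n ≤ i → ∀ w : N.cosyzygy (i + 1),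
      (∀ r ∈ IsLocalRing.maximalIdeal R, r • w = 0) →
      ∃ y : (N.cosyzygySequence i).X₂, (∀ r ∈ IsLocalRing.maximalIdeal R, r • y = 0) ∧
        (N.cosyzygySequence i).g y = w) :
    HasInjectiveDimensionLT N (n + 1) := by
  have hk : ∀ i, n < i → Subsingleton
      (Abelian.Ext (ModuleCat.of R (R ⧸ IsLocalRing.maximalIdeal R)) N i) := by
    intro i hi
    obtain ⟨i, rfl⟩ : ∃ j, i = j + 1 := ⟨i - 1, by lia⟩
    have hI : Injective (N.cosyzygySequence i).X₂ :=
      inferInstanceAs (Injective (Injective.under _))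
    have := subsingleton_ext_one_quotient_of_lifts _ (N.shortExact_cosyzygySequence i)
      (h i (by lia))
    rw [← zero_add i]
    exact (N.subsingleton_ext_cosyzygy_iff _ i 0).1 this
  have hK : Injective (N.cosyzygy n) :=
    ModuleCat.injective_of_subsingleton_ext_one_quotient _ fun J =>
      (N.subsingleton_ext_cosyzygy_iff _ n 0).2
        (subsingleton_ext_quotient_of_residueField N n hk J _ (by lia))
  rw [injective_iff_hasInjectiveDimensionLT_one] at hK
  have := (N.hasInjectiveDimensionLT_cosyzygy_iff n 0).1 hK
  rwa [zero_add] at this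

/-- Let `η : R → I 0 → I 1 → ⋯` be an injective resolution of a local ring `R` and let `M` be a
module with a minimal free resolution `F`. This structure records the properties of the total
complex `T` of `I ⊗ F` which involve only the free module of degree `0`: the projection `q` to
`I ⊗ F₀`, which commutes with the differentials on socles, its section `s`, and the
augmentation `ε` from the cocycles of degree `0`. -/
structure MinimalModel {R : Type} [CommRing R] [IsLocalRing R] (I : ℕ → ModuleCat.{0} R)
    (D : ∀ i, I i →ₗ[R] I (i + 1)) (η : R →ₗ[R] I 0)
    (M : Type) [AddCommGroup M] [Module R M] where
  rank : ℕ
  gen : Fin rank → M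
  span_gen : Submodule.span R (Set.range gen) = ⊤
  T : ℕ → ModuleCat.{0} R
  injective : ∀ i, Module.Injective R (T i)
  d : ∀ i, T i →ₗ[R] T (i + 1)
  d_d : ∀ i t, d (i + 1) (d i t) = 0
  exact : ∀ i t, d (i + 1) t = 0 → ∃ u, d i u = t
  q : ∀ i, T i →ₗ[R] (Fin rank → I i)
  q_d : ∀ i (f : M →ₗ[R] R) t,
    ∑ j, f (gen j) • q (i + 1) (d i t) j = D i (∑ j, f (gen j) • q i t j)
  q_d_socle : ∀ i t, (∀ r ∈ IsLocalRing.maximalIdeal R, r • t = 0) → ∀ j,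
    q (i + 1) (d i t) j = D i (q i t j)
  s : ∀ i, (Fin rank → I i) →ₗ[R] T i
  q_s : ∀ i y, q i (s i y) = y
  d_s : ∀ i y, d i (s i y) = s (i + 1) (fun j => D i (y j))
  ε : LinearMap.ker (d 0) →ₗ[R] M
  ε_surjective : Function.Surjective ε
  ker_injective : Module.Injective R (LinearMap.ker ε)
  q_ε : ∀ (f : M →ₗ[R] R) (z : LinearMap.ker (d 0)), ∑ j, f (gen j) • q 0 z j = η (f (ε z))

namespace MinimalModel

variable {R : Type} [CommRing R] [IsLocalRing R] {I : ℕ → ModuleCat.{0} R}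
  {D : ∀ i, I i →ₗ[R] I (i + 1)} {η : R →ₗ[R] I 0}
  {N : Type} [AddCommGroup N] [Module R N]

/-- The map induced by a linear map from `N` to a free module. -/
noncomputable def pushforward (W : MinimalModel I D η N) {b : ℕ} (g : N →ₗ[R] (Fin b → R))
    (i : ℕ) : W.T i →ₗ[R] (Fin b → I i) :=
  LinearMap.pi fun k => ∑ l, g (W.gen l) k • (LinearMap.proj l ∘ₗ W.q i)

variable (W : MinimalModel I D η N) {b : ℕ} (g : N →ₗ[R] (Fin b → R))

theorem pushforward_apply (i : ℕ) (t : W.T i) (k : Fin b) :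
    W.pushforward g i t k = ∑ l, g (W.gen l) k • W.q i t l := by
  simp [pushforward]

theorem pushforward_d (i : ℕ) (t : W.T i) (k : Fin b) :
    W.pushforward g (i + 1) (W.d i t) k = D i (W.pushforward g i t k) := by
  simp only [pushforward_apply]
  exact W.q_d i (LinearMap.proj k ∘ₗ g) t

theorem pushforward_ker (z : LinearMap.ker (W.d 0)) (k : Fin b) :
    W.pushforward g 0 z k = η (g (W.ε z) k) := by
  simp only [pushforward_apply]
  exact W.q_ε (LinearMap.proj k ∘ₗ g) z

theorem pushforward_socle (hg : ∀ x k, g x k ∈ IsLocalRing.maximalIdeal R) (i : ℕ) (t : W.T i)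
    (ht : ∀ r ∈ IsLocalRing.maximalIdeal R, r • t = 0) : W.pushforward g i t = 0 := by
  ext k
  rw [pushforward_apply]
  refine Finset.sum_eq_zero fun l _ => ?_
  rw [← Pi.smul_apply, ← map_smul, ht _ (hg _ _), map_zero]
  rfl

theorem sum_pushforward {M : Type} [AddCommGroup M] [Module R M] (a : Fin b → M)
    (hg : ∀ x, ∑ k, g x k • a k = 0) (f : M →ₗ[R] R) (i : ℕ) (t : W.T i) :
    ∑ k, f (a k) • W.pushforward g i t k = 0 := by
  simp only [pushforward_apply, Finset.smul_sum]
  rw [Finset.sum_comm]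
  refine Finset.sum_eq_zero fun l _ => ?_
  simp only [smul_smul, ← Finset.sum_smul]
  have := congr_arg f (hg (W.gen l))
  simp only [map_sum, map_smul, smul_eq_mul, map_zero] at this
  rw [Finset.sum_congr rfl fun k _ => mul_comm _ _, this, zero_smul]

end MinimalModel

theorem LinearMap.exists_factor_of_surjective {R A B C : Type} [CommRing R]
    [AddCommGroup A] [Module R A] [AddCommGroup B] [Module R B] [AddCommGroup C] [Module R C]
    (α : A →ₗ[R] B) (hα : Function.Surjective α) (β : A →ₗ[R] C)
    (h : LinearMap.ker α ≤ LinearMap.ker β) : ∃ ε : B →ₗ[R] C, ∀ p, ε (α p) = β p := by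
  refine ⟨(LinearMap.ker α).liftQ β h ∘ₗ (α.quotKerEquivOfSurjective hα).symm, fun p => ?_⟩
  have : (α.quotKerEquivOfSurjective hα).symm (α p) = Submodule.Quotient.mk p := by
    rw [LinearEquiv.symm_apply_eq]
    rfl
  simp only [LinearMap.comp_apply, LinearEquiv.coe_coe, this]
  rfl

theorem Module.Injective.of_exact {R A B C : Type} [CommRing R]
    [AddCommGroup A] [Module R A] [AddCommGroup B] [Module R B] [AddCommGroup C] [Module R C]
    [Module.Injective R A] [Module.Injective R B] (f : A →ₗ[R] B) (g : B →ₗ[R] C)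
    (hf : Function.Injective f) (hg : Function.Surjective g) (h : Function.Exact f g) :
    Module.Injective R C := by
  have hA : CategoryTheory.Injective (ModuleCat.of R A) :=
    Module.injective_object_of_injective_module R A
  have hB : CategoryTheory.Injective (ModuleCat.of R B) :=
    Module.injective_object_of_injective_module R B
  have hC : HasInjectiveDimensionLT (ModuleCat.of R C) 1 :=
    (ModuleCat.shortExact_of_linearMap f g hf hg h).hasInjectiveDimensionLT_X₃ 1
      (inferInstanceAs (HasInjectiveDimensionLT (ModuleCat.of R B) 1))
      (inferInstanceAs (HasInjectiveDimensionLT (ModuleCat.of R A) (1 + 1)))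
  have : CategoryTheory.Injective (ModuleCat.of R C) := inferInstance
  exact Module.injective_module_of_injective_object R C

theorem Module.Injective.prod {R : Type} [CommRing R] (A B : Type)
    [AddCommGroup A] [Module R A] [AddCommGroup B] [Module R B]
    [Module.Injective R A] [Module.Injective R B] : Module.Injective R (A × B) := by
  have hA : CategoryTheory.Injective (ModuleCat.of R A) :=
    Module.injective_object_of_injective_module R A
  have hB : CategoryTheory.Injective (ModuleCat.of R B) :=
    Module.injective_object_of_injective_module R B
  have hC : HasInjectiveDimensionLT (ModuleCat.of R (A × B)) 1 :=
    (ModuleCat.shortExact_of_linearMap (LinearMap.inl R A B) (LinearMap.snd R A B)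
      LinearMap.inl_injective LinearMap.snd_surjective
      Function.Exact.inl_snd).hasInjectiveDimensionLT_X₂ 1
      (inferInstanceAs (HasInjectiveDimensionLT (ModuleCat.of R A) 1))
      (inferInstanceAs (HasInjectiveDimensionLT (ModuleCat.of R B) 1))
  have : CategoryTheory.Injective (ModuleCat.of R (A × B)) := inferInstance
  exact Module.injective_module_of_injective_object R (A × B)

theorem MinimalModel.nonempty_of_presentation {R : Type} [CommRing R] [IsNoetherianRing R]
    [IsLocalRing R] {I : ℕ → ModuleCat.{0} R}
    {D : ∀ i, I i →ₗ[R] I (i + 1)} {η : R →ₗ[R] I 0} (hI : ∀ i, Module.Injective R (I i))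
    (hη : Function.Injective η) (hηD : Function.Exact η (D 0))
    (hD : ∀ i, Function.Exact (D i) (D (i + 1)))
    {M : Type} [AddCommGroup M] [Module R M] {b : ℕ} (a : Fin b → M)
    (ha : Submodule.span R (Set.range a) = ⊤)
    (hmin : ∀ v : Fin b → R, ∑ k, v k • a k = 0 → ∀ k, v k ∈ IsLocalRing.maximalIdeal R)
    (W : MinimalModel I D η (LinearMap.ker (Fintype.linearCombination R a))) :
    Nonempty (MinimalModel I D η M) := by
  let N := LinearMap.ker (Fintype.linearCombination R a)
  let g : N →ₗ[R] (Fin b → R) := N.subtype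
  have hg : ∀ x, ∑ k, g x k • a k = 0 := fun x => x.2
  let Φ := W.pushforward g
  let d : ∀ i, (W.T (i + 1) × (Fin b → I i)) →ₗ[R] (W.T (i + 1 + 1) × (Fin b → I (i + 1))) :=
    fun i => LinearMap.prod (-(W.d (i + 1) ∘ₗ LinearMap.fst R _ _))
      (Φ (i + 1) ∘ₗ LinearMap.fst R _ _ +
        LinearMap.pi fun k => D i ∘ₗ LinearMap.proj k ∘ₗ LinearMap.snd R _ _)
  have d_fst : ∀ i t, (d i t).1 = -W.d (i + 1) t.1 := fun i t => rfl
  have d_snd : ∀ i t k, (d i t).2 k = Φ (i + 1) t.1 k + D i (t.2 k) := fun i t k => rfl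
  have lift : ∀ i (t : W.T (i + 1) × (Fin b → I i)), d i t = 0 →
      ∃ u, W.d i u = t.1 ∧ ∀ k, D i (Φ i u k + t.2 k) = 0 := by
    intro i t ht
    obtain ⟨u, hu⟩ := W.exact i t.1 (neg_eq_zero.1 ((d_fst i t).symm.trans (congr_arg Prod.fst ht)))
    refine ⟨u, hu, fun k => ?_⟩
    rw [map_add, ← W.pushforward_d, hu]
    exact (d_snd i t k).symm.trans (congr_fun (congr_arg Prod.snd ht) k)
  let α₀ : (W.T 0 × (Fin b → R)) →ₗ[R] (W.T 1 × (Fin b → I 0)) :=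
    LinearMap.prod (W.d 0 ∘ₗ LinearMap.fst R _ _)
      ((LinearMap.pi fun k => η ∘ₗ LinearMap.proj k ∘ₗ LinearMap.snd R _ _) -
        Φ 0 ∘ₗ LinearMap.fst R _ _)
  have α₀_fst : ∀ p, (α₀ p).1 = W.d 0 p.1 := fun p => rfl
  have α₀_snd : ∀ p k, (α₀ p).2 k = η (p.2 k) - Φ 0 p.1 k := fun p k => rfl
  have hα₀ : ∀ p, α₀ p ∈ LinearMap.ker (d 0) := by
    intro p
    refine Prod.ext ?_ (funext fun k => ?_)
    · rw [d_fst, α₀_fst, W.d_d, neg_zero]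
      rfl
    · rw [d_snd, α₀_fst, α₀_snd, map_sub, W.pushforward_d, hηD.apply_apply_eq_zero]
      simp [Φ]
  let α : (W.T 0 × (Fin b → R)) →ₗ[R] LinearMap.ker (d 0) := α₀.codRestrict _ hα₀
  have hα : Function.Surjective α := by
    rintro ⟨t, ht⟩
    obtain ⟨u, hu, hk⟩ := lift 0 t ht
    choose v hv using fun k => (hηD _).1 (hk k)
    refine ⟨(u, v), Subtype.ext (Prod.ext hu (funext fun k => ?_))⟩
    change η (v k) - Φ 0 u k = t.2 k
    rw [hv, add_sub_cancel_left]
  let β : (W.T 0 × (Fin b → R)) →ₗ[R] M :=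
    Fintype.linearCombination R a ∘ₗ LinearMap.snd R _ _
  have hker : ∀ p, α p = 0 → ∃ z : LinearMap.ker (W.d 0), (z : W.T 0) = p.1 ∧
      p.2 = g (W.ε z) := by
    intro p hp
    have hp : α₀ p = 0 := congr_arg Subtype.val hp
    refine ⟨⟨p.1, congr_arg Prod.fst hp⟩, rfl, funext fun k => hη ?_⟩
    rw [← W.pushforward_ker]
    exact sub_eq_zero.1 (congr_fun (congr_arg Prod.snd hp) k)
  obtain ⟨ε, hε⟩ := LinearMap.exists_factor_of_surjective α hα β (by
    intro p hp
    obtain ⟨z, -, hz⟩ := hker p hp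
    change Fintype.linearCombination R a p.2 = 0
    rw [hz]
    exact (W.ε z).2)
  have hWinj := W.injective
  refine ⟨{
    rank := b
    gen := a
    span_gen := ha
    T := fun i => ModuleCat.of R (W.T (i + 1) × (Fin b → I i))
    injective := fun i => ?_
    d := d
    d_d := fun i t => ?_
    exact := fun i t ht => ?_
    q := fun i => LinearMap.snd R _ _
    q_d := fun i f t => ?_
    q_d_socle := fun i t ht k => ?_
    s := fun i => LinearMap.inr R _ _
    q_s := fun i y => rfl
    d_s := fun i y => ?_
    ε := ε
    ε_surjective := ?_
    ker_injective := ?_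
    q_ε := fun f z => ?_ }⟩
  · have := Module.Injective.pi R (fun _ : Fin b => I i)
    exact Module.Injective.prod (W.T (i + 1)) (Fin b → I i)
  · refine Prod.ext ?_ (funext fun k => ?_)
    · rw [d_fst, d_fst, map_neg, W.d_d]
      simp
    · rw [d_snd, d_snd, d_fst, map_add, (hD i).apply_apply_eq_zero, map_neg]
      simp [Φ, W.pushforward_d]
  · obtain ⟨u, hu, hk⟩ := lift (i + 1) t ht
    choose v hv using fun k => (hD i _).1 (hk k)
    refine ⟨(-u, v), Prod.ext ?_ (funext fun k => ?_)⟩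
    · rw [d_fst, map_neg, neg_neg, hu]
    · rw [d_snd, hv, map_neg]
      simp
  · change ∑ j, f (a j) • (d i t).2 j = _
    simp only [d_snd, smul_add, Finset.sum_add_distrib]
    rw [W.sum_pushforward g a hg, zero_add, map_sum]
    simp only [map_smul]
    rfl
  · change (d i t).2 k = D i (t.2 k)
    have h0 : Φ (i + 1) t.1 = 0 := W.pushforward_socle g (fun x => hmin _ (hg x)) _ _
      fun r hr => congr_arg Prod.fst (ht r hr)
    rw [d_snd, h0]
    simp
  · refine Prod.ext ?_ (funext fun k => ?_)
    · rw [d_fst]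
      simp
    · rw [d_snd]
      simp
  · intro m
    have hm : m ∈ LinearMap.range (Fintype.linearCombination R a) := by
      rw [Fintype.range_linearCombination, ha]
      trivial
    obtain ⟨v, rfl⟩ := hm
    exact ⟨α (0, v), hε _⟩
  · let γ : W.T 0 →ₗ[R] LinearMap.ker ε :=
      (α ∘ₗ LinearMap.inl R _ _).codRestrict _ fun u => by
        change ε (α (u, 0)) = 0
        rw [hε]
        exact map_zero (Fintype.linearCombination R a)
    have hκ := W.ker_injective
    refine Module.Injective.of_exact
      ((LinearMap.ker (W.d 0)).subtype ∘ₗ (LinearMap.ker W.ε).subtype) γ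
      (Subtype.val_injective.comp Subtype.val_injective) ?_ ?_
    · rintro ⟨z, hz⟩
      obtain ⟨⟨u, v⟩, rfl⟩ := hα z
      have hv : v ∈ N := (hε (u, v)).symm.trans hz
      obtain ⟨z, hz⟩ := W.ε_surjective ⟨v, hv⟩
      have hz0 : α (z, v) = 0 := by
        refine Subtype.ext (Prod.ext z.2 (funext fun k => ?_))
        change η (v k) - Φ 0 z k = 0
        rw [W.pushforward_ker, hz]
        exact sub_self _
      refine ⟨u - z, Subtype.ext ?_⟩
      change α (u - z, 0) = α (u, v)
      rw [← sub_zero (α (u, v)), ← hz0, ← map_sub]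
      simp
    · intro u
      constructor
      · intro hu
        obtain ⟨z, hz, hz'⟩ := hker (u, 0) (congr_arg Subtype.val hu)
        exact ⟨⟨z, Subtype.ext hz'.symm⟩, hz⟩
      · rintro ⟨⟨z, hz⟩, rfl⟩
        refine Subtype.ext (Subtype.ext (Prod.ext z.2 (funext fun k => ?_)))
        change η 0 - Φ 0 z k = 0
        rw [W.pushforward_ker, LinearMap.mem_ker.1 hz]
        simp
  · obtain ⟨⟨u, v⟩, rfl⟩ := hα z
    rw [hε]
    change ∑ j, f (a j) • (η (v j) - Φ 0 u j) = η (f (∑ j, v j • a j))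
    simp only [smul_sub, Finset.sum_sub_distrib]
    rw [W.sum_pushforward g a hg, sub_zero, map_sum, map_sum]
    refine Finset.sum_congr rfl fun j _ => ?_
    rw [← map_smul, map_smul f, smul_eq_mul, smul_eq_mul, mul_comm]

open TensorProduct in
theorem IsLocalRing.exists_minimal_generators (R : Type) [CommRing R] [IsLocalRing R]
    (M : Type) [AddCommGroup M] [Module R M] [Module.Finite R M] :
    ∃ (b : ℕ) (a : Fin b → M), Submodule.span R (Set.range a) = ⊤ ∧
      ∀ v : Fin b → R, ∑ k, v k • a k = 0 → ∀ k, v k ∈ IsLocalRing.maximalIdeal R := by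
  let B := Module.finBasis (ResidueField R) (ResidueField R ⊗[R] M)
  have hsurj : Function.Surjective (TensorProduct.mk R (ResidueField R) M 1) := by
    rw [← LinearMap.range_eq_top, ← Submodule.map_top, map_tensorProduct_mk_eq_top]
  choose a ha using fun j => hsurj (B j)
  refine ⟨_, a, span_eq_top_of_tmul_eq_basis a B ha, fun v hv k => ?_⟩
  have h := congr_arg (TensorProduct.mk R (ResidueField R) M 1) hv
  simp only [map_sum, map_smul, ha, map_zero] at h
  have h' : ∑ j, residue R (v j) • B j = 0 := by
    rw [← h]
    exact Finset.sum_congr rfl fun j _ => algebraMap_smul (ResidueField R) (v j) (B j)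
  exact (residue_eq_zero_iff _).1 (Fintype.linearIndependent_iff.1 B.linearIndependent _ h' k)

theorem ker_linearCombination_eq_bot_of_projective {R : Type} [CommRing R] [IsNoetherianRing R]
    [IsLocalRing R] {M : Type} [AddCommGroup M] [Module R M] [Module.Projective R M] {b : ℕ}
    (a : Fin b → M) (ha : Submodule.span R (Set.range a) = ⊤)
    (hmin : ∀ v : Fin b → R, ∑ k, v k • a k = 0 → ∀ k, v k ∈ IsLocalRing.maximalIdeal R) :
    LinearMap.ker (Fintype.linearCombination R a) = ⊥ := by
  set π := Fintype.linearCombination R a with hπ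
  obtain ⟨σ, hσ⟩ := π.exists_rightInverse_of_surjective
    (by rw [hπ, Fintype.range_linearCombination, ha])
  have hσ' : ∀ m, π (σ m) = m := fun m => LinearMap.congr_fun hσ m
  refine Submodule.eq_bot_of_le_smul_of_le_jacobson_bot (IsLocalRing.maximalIdeal R) _
    (IsNoetherian.noetherian _) (fun v hv => ?_) (IsLocalRing.maximalIdeal_le_jacobson _)
  have hv' : v = ∑ k, v k • (Pi.single k 1 - σ (π (Pi.single k 1)) : Fin b → R) := by
    have h1 : v = ∑ k, v k • (Pi.single k 1 : Fin b → R) := by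
      ext j
      simp [Finset.sum_apply, Pi.single_apply]
    have h2 : ∑ k, v k • σ (π (Pi.single k 1)) = 0 := by
      simp only [← map_smul, ← map_sum]
      rw [← h1, LinearMap.mem_ker.1 hv, map_zero]
    simp only [smul_sub, Finset.sum_sub_distrib]
    rw [h2, sub_zero]
    exact h1
  rw [hv']
  refine Submodule.sum_mem _ fun k _ => Submodule.smul_mem_smul (hmin v hv k) ?_
  rw [LinearMap.mem_ker, map_sub, hσ', sub_self]

/-- The model of the zero module. -/
noncomputable def MinimalModel.ofSubsingleton {R : Type} [CommRing R] [IsLocalRing R]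
    (I : ℕ → ModuleCat.{0} R) (D : ∀ i, I i →ₗ[R] I (i + 1)) (η : R →ₗ[R] I 0)
    (M : Type) [AddCommGroup M] [Module R M] [Subsingleton M] : MinimalModel I D η M where
  rank := 0
  gen := Fin.elim0
  span_gen := Subsingleton.elim _ _
  T _ := ModuleCat.of R PUnit
  injective _ := ⟨fun _ _ _ _ _ _ _ _ _ => ⟨0, fun _ => rfl⟩⟩
  d _ := 0
  d_d _ _ := rfl
  exact _ _ _ := ⟨0, rfl⟩
  q _ := 0
  q_d _ _ _ := by simp
  q_d_socle _ _ _ j := j.elim0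
  s _ := 0
  q_s _ _ := Subsingleton.elim _ _
  d_s _ _ := rfl
  ε := 0
  ε_surjective _ := ⟨0, Subsingleton.elim _ _⟩
  ker_injective := ⟨fun _ _ _ _ _ _ _ _ _ => ⟨0, fun _ => Subsingleton.elim _ _⟩⟩
  q_ε f z := by simp [Subsingleton.elim _ (0 : M)]

theorem MinimalModel.nonempty_of_hasProjectiveDimensionLT {R : Type} [CommRing R]
    [IsNoetherianRing R] [IsLocalRing R] {I : ℕ → ModuleCat.{0} R}
    {D : ∀ i, I i →ₗ[R] I (i + 1)} {η : R →ₗ[R] I 0} (hI : ∀ i, Module.Injective R (I i))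
    (hη : Function.Injective η) (hηD : Function.Exact η (D 0))
    (hD : ∀ i, Function.Exact (D i) (D (i + 1))) (n : ℕ) :
    ∀ (M : Type) [AddCommGroup M] [Module R M] [Module.Finite R M],
      HasProjectiveDimensionLT (ModuleCat.of R M) n → Nonempty (MinimalModel I D η M) := by
  induction n with
  | zero =>
    intro M _ _ _ h
    have hM : Subsingleton M :=
      ModuleCat.isZero_iff_subsingleton.1 (isZero_of_hasProjectiveDimensionLT_zero (ModuleCat.of R M))
    exact ⟨MinimalModel.ofSubsingleton I D η M⟩
  | succ n ih =>
    intro M _ _ _ h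
    obtain ⟨b, a, ha, hmin⟩ := IsLocalRing.exists_minimal_generators R M
    have hS := ModuleCat.shortExact_of_linearMap
      (LinearMap.ker (Fintype.linearCombination R a)).subtype (Fintype.linearCombination R a)
      (Submodule.subtype_injective _)
      (LinearMap.range_eq_top.1 (by rw [Fintype.range_linearCombination, ha]))
      (LinearMap.exact_subtype_ker_map _)
    have hN : HasProjectiveDimensionLT
        (ModuleCat.of R (LinearMap.ker (Fintype.linearCombination R a))) n := by
      obtain _ | n := n
      · have hP : Projective (ModuleCat.of R M) := inferInstance
        have : Module.Projective R M := (IsProjective.iff_projective M).2 hP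
        apply Limits.IsZero.hasProjectiveDimensionLT_zero
        rw [ModuleCat.isZero_iff_subsingleton]
        change Subsingleton (LinearMap.ker (Fintype.linearCombination R a))
        rw [ker_linearCombination_eq_bot_of_projective a ha hmin]
        infer_instance
      · have hF : Projective (ModuleCat.of R (Fin b → R)) :=
          (IsProjective.iff_projective _).1 inferInstance
        exact hS.hasProjectiveDimensionLT_X₁ (n + 1)
          (inferInstanceAs (HasProjectiveDimensionLT (ModuleCat.of R (Fin b → R)) (n + 1))) h
    obtain ⟨W⟩ := ih _ hN
    exact MinimalModel.nonempty_of_presentation hI hη hηD hD a ha hmin W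

namespace MinimalModel

variable {R : Type} [CommRing R] [IsLocalRing R] {I : ℕ → ModuleCat.{0} R}
  {D : ∀ i, I i →ₗ[R] I (i + 1)} {η : R →ₗ[R] I 0}
  {M : Type} [AddCommGroup M] [Module R M]

theorem hasInjectiveDimensionLT_ker_d (W : MinimalModel I D η M) {n : ℕ}
    (h : HasInjectiveDimensionLT (ModuleCat.of R M) (n + 1)) (i k : ℕ) (hn : n ≤ i + k) :
    HasInjectiveDimensionLT (ModuleCat.of R (LinearMap.ker (W.d i))) (k + 1) := by
  induction i generalizing k with
  | zero =>
    have hM := hasInjectiveDimensionLT_of_ge (ModuleCat.of R M) (n + 1) (k + 1) (by lia)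
    have hε := W.ker_injective
    have hκ : Injective (ModuleCat.of R (LinearMap.ker W.ε)) :=
      Module.injective_object_of_injective_module R _
    exact (ModuleCat.shortExact_of_linearMap (LinearMap.ker W.ε).subtype W.ε
      (Submodule.subtype_injective _) W.ε_surjective
      (LinearMap.exact_subtype_ker_map _)).hasInjectiveDimensionLT_X₂ (k + 1)
      (hasInjectiveDimensionLT_of_ge (ModuleCat.of R (LinearMap.ker W.ε)) 1 (k + 1) (by lia)) hM
  | succ i ih =>
    have hT := W.injective i
    have hTi : Injective (ModuleCat.of R (W.T i)) :=
      Module.injective_object_of_injective_module R _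
    have hS := ModuleCat.shortExact_of_linearMap (LinearMap.ker (W.d i)).subtype
      ((W.d i).codRestrict (LinearMap.ker (W.d (i + 1))) (W.d_d i))
      (Submodule.subtype_injective _)
      (fun t => (W.exact i t t.2).imp fun u hu => Subtype.ext hu)
      (fun u => ⟨fun hu => ⟨⟨u, congr_arg Subtype.val hu⟩, rfl⟩,
        fun ⟨z, hz⟩ => hz ▸ Subtype.ext z.2⟩)
    exact (hS.hasInjectiveDimensionLT_X₃_iff k hTi).2 (ih (k + 1) (by lia))

theorem exists_socle_lift (W : MinimalModel I D η M) [Nontrivial M] {n : ℕ}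
    (h : HasInjectiveDimensionLT (ModuleCat.of R M) (n + 1)) {i : ℕ} (hi : n ≤ i)
    (z : I (i + 1)) (hD : D (i + 1) z = 0)
    (hz : ∀ r ∈ IsLocalRing.maximalIdeal R, r • z = 0) :
    ∃ y : I i, (∀ r ∈ IsLocalRing.maximalIdeal R, r • y = 0) ∧ D i y = z := by
  have hrank : W.rank ≠ 0 := by
    intro h0
    have : IsEmpty (Fin W.rank) := by
      rw [h0]
      infer_instance
    have hs := W.span_gen
    rw [Set.range_eq_empty, Submodule.span_empty] at hs
    exact bot_ne_top hs
  have hZ := W.hasInjectiveDimensionLT_ker_d h i 0 hi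
  have hZ' : Injective (ModuleCat.of R (LinearMap.ker (W.d i))) := inferInstance
  have hZi : Module.Injective R (LinearMap.ker (W.d i)) :=
    Module.injective_module_of_injective_object R _
  obtain ⟨ρ, hρ⟩ := hZi.out (LinearMap.ker (W.d i)).subtype (Submodule.subtype_injective _)
    LinearMap.id
  let j : Fin W.rank := ⟨0, Nat.pos_of_ne_zero hrank⟩
  have ht0 : W.d (i + 1) (W.s (i + 1) (Pi.single j z)) = 0 := by
    rw [W.d_s]
    convert map_zero (W.s (i + 1 + 1)) with k
    obtain rfl | hk := eq_or_ne k j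
    · rw [Pi.single_eq_same, hD, Pi.zero_apply]
    · rw [Pi.single_eq_of_ne hk, map_zero, Pi.zero_apply]
  obtain ⟨u, hu⟩ := W.exact i _ ht0
  have hsoc : ∀ r ∈ IsLocalRing.maximalIdeal R, r • (u - (ρ u : W.T i)) = 0 := by
    intro r hr
    have hru : r • u ∈ LinearMap.ker (W.d i) := by
      rw [LinearMap.mem_ker, map_smul, hu, ← map_smul, ← Pi.single_smul, hz r hr,
        Pi.single_zero, map_zero]
    have h1 := congr_arg Subtype.val (hρ ⟨r • u, hru⟩)
    have h2 : ((ρ (r • u) : LinearMap.ker (W.d i)) : W.T i) = r • u := h1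
    rw [map_smul] at h2
    rw [smul_sub, ← h2]
    exact sub_self _
  refine ⟨W.q i (u - ρ u) j, fun r hr => ?_, ?_⟩
  · rw [← Pi.smul_apply, ← map_smul, hsoc r hr, map_zero]
    rfl
  · rw [← W.q_d_socle i _ hsoc, map_sub, hu, (ρ u).2, sub_zero, W.q_s, Pi.single_eq_same]

end MinimalModel

/-- A Noetherian local ring admitting a nonzero finitely generated module of finite projective
dimension and finite injective dimension has finite injective dimension over itself. -/
theorem hasInjectiveDimensionLT_self_of_module {R : Type} [CommRing R] [IsNoetherianRing R]
    [IsLocalRing R] (M : ModuleCat.{0} R) [Nontrivial M] [Module.Finite R M] (n p : ℕ)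
    (hinj : HasInjectiveDimensionLT M (n + 1)) (hproj : HasProjectiveDimensionLT M p) :
    HasInjectiveDimensionLT (ModuleCat.of R R) (n + 1) := by
  let N := ModuleCat.of R R
  let S := N.cosyzygySequence
  have hS : ∀ i, (S i).ShortExact := N.shortExact_cosyzygySequence
  have hf : ∀ i, Function.Injective (S i).f := fun i => (hS i).moduleCat_injective_f
  have hg : ∀ i, Function.Surjective (S i).g := fun i => (hS i).moduleCat_surjective_g
  have he : ∀ i x, (S i).g x = 0 → ∃ y, (S i).f y = x := fun i =>
    (ShortComplex.moduleCat_exact_iff _).1 (hS i).exact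
  have hfg : ∀ i x, (S i).g ((S i).f x) = 0 := fun i x => by
    rw [← ModuleCat.comp_apply, (S i).zero]
    rfl
  let D : ∀ i, (S i).X₂ →ₗ[R] (S (i + 1)).X₂ := fun i => (S (i + 1)).f.hom ∘ₗ (S i).g.hom
  have hDz : ∀ i x, D i x = 0 → (S i).g x = 0 := fun i x hx =>
    hf (i + 1) (hx.trans (map_zero _).symm)
  let η : R →ₗ[R] (S 0).X₂ := (S 0).f.hom
  have hI : ∀ i, Module.Injective R (S i).X₂ := fun i => by
    have : Injective (S i).X₂ := inferInstanceAs (Injective (Injective.under _))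
    exact Module.injective_module_of_injective_object R _
  have hηD : Function.Exact η (D 0) := fun x =>
    ⟨fun hx => he 0 x (hDz 0 x hx), fun ⟨y, hy⟩ => by
      rw [← hy]
      exact (congr_arg (S 1).f (hfg 0 y)).trans (map_zero _)⟩
  have hD : ∀ i, Function.Exact (D i) (D (i + 1)) := fun i x =>
    ⟨fun hx => by
      obtain ⟨y, hy⟩ := he (i + 1) x (hDz (i + 1) x hx)
      obtain ⟨w, rfl⟩ := hg i y
      exact ⟨w, hy⟩, fun ⟨y, hy⟩ => by
      rw [← hy]
      exact (congr_arg (S (i + 1 + 1)).f (hfg (i + 1) ((S i).g y))).trans (map_zero _)⟩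
  obtain ⟨W⟩ := MinimalModel.nonempty_of_hasProjectiveDimensionLT (η := η) hI (hf 0) hηD hD p M
    hproj
  have : Module.Finite R N := inferInstanceAs (Module.Finite R R)
  refine hasInjectiveDimensionLT_of_cosyzygy_lifts N n fun i hi w hw => ?_
  obtain ⟨y, hy, hyw⟩ := W.exists_socle_lift hinj hi ((S (i + 1)).f w)
    ((congr_arg (S (i + 1 + 1)).f (hfg (i + 1) w)).trans (map_zero _))
    (fun r hr => by
      rw [← map_smul]
      exact (congr_arg (S (i + 1)).f (hw r hr)).trans (map_zero _))
  exact ⟨y, hy, hf (i + 1) hyw⟩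

theorem injDimLE_iff_hasInjectiveDimensionLT (R : Type) [CommRing R] (M : ModuleCat R) (n : ℕ) :
    injDimLE R M n ↔ HasInjectiveDimensionLT M (n + 1) := by
  constructor
  · intro h
    exact hasInjectiveDimensionLT_of_enoughProjectives M (n + 1) fun X =>
      (extVanish_iff_subsingleton_ext R X M n).1 (h X (n + 1) n.lt_succ_self)
  · intro h X i hi
    obtain ⟨i, rfl⟩ : ∃ j, i = j + 1 := ⟨i - 1, by lia⟩
    rw [extVanish_iff_subsingleton_ext]
    exact HasInjectiveDimensionLT.subsingleton M (n + 1) (i + 1) hi X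

theorem projDimLE_iff_hasProjectiveDimensionLT (R : Type) [CommRing R] (M : ModuleCat R)
    (n : ℕ) : projDimLE R M n ↔ HasProjectiveDimensionLT M (n + 1) := by
  constructor
  · intro h
    exact hasProjectiveDimensionLT_of_enoughInjectives M (n + 1) fun X =>
      (extVanish_iff_subsingleton_ext R M X n).1 (h X (n + 1) n.lt_succ_self)
  · intro h X i hi
    obtain ⟨i, rfl⟩ : ∃ j, i = j + 1 := ⟨i - 1, by lia⟩
    rw [extVanish_iff_subsingleton_ext]
    exact HasProjectiveDimensionLT.subsingleton M (n + 1) (i + 1) hi X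

theorem gorenstein_iff_exists_fg_module_finite_injDim_finite_projDim
    (R : Type) [CommRing R] [IsNoetherianRing R] [IsLocalRing R] :
    IsGorensteinRing R ↔
      ∃ M : ModuleCat R, Nontrivial M ∧ Module.Finite R M ∧
        (∃ n : ℕ, injDimLE R M n) ∧ (∃ n : ℕ, projDimLE R M n) := by
  constructor
  · intro h
    refine ⟨ModuleCat.of R R, inferInstanceAs (Nontrivial R), inferInstanceAs (Module.Finite R R),
      h, 0, ?_⟩
    rw [projDimLE_iff_hasProjectiveDimensionLT]
    have : Projective (ModuleCat.of R R) := (IsProjective.iff_projective R).1 inferInstance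
    exact inferInstanceAs (HasProjectiveDimensionLT (ModuleCat.of R R) 1)
  · rintro ⟨M, _, _, ⟨n, hn⟩, ⟨p, hp⟩⟩
    rw [injDimLE_iff_hasInjectiveDimensionLT] at hn
    rw [projDimLE_iff_hasProjectiveDimensionLT] at hp
    exact ⟨n, (injDimLE_iff_hasInjectiveDimensionLT R _ n).2
      (hasInjectiveDimensionLT_self_of_module M n (p + 1) hn hp)⟩
end

section
/- Let R be a commutative Noetherian local ring with residue field k. R is Gorenstein if and only if RHom_R(k,R) is quasi-isomorphic to a shift of k in the derived category of R, i.e., Ext^i_R(k,R) = 0 for all i except one value d, where Ext^d_R(k,R) is one-dimensional over k. -/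
/-!
STATEMENT 2: Let `R` be a commutative Noetherian local ring with residue field `k`.
`R` is Gorenstein if and only if `RHom_R(k,R)` is quasi-isomorphic to a shift of `k`,
i.e. there is a `d` such that `Ext^i_R(k,R) = 0` for all `i ≠ d` and `Ext^d_R(k,R)` is
one-dimensional over `k` (i.e. isomorphic to `k` as an `R`-module).
-/

open CategoryTheory

universe w v u t

namespace CategoryTheory.ProjectiveResolution

open Limits

section

variable {C : Type u} [Category.{v} C] [Abelian C] [HasExt.{w} C] {X Y : C}
  (P : ProjectiveResolution X)

lemma extMk_smul {R : Type t} [Ring R] [Linear R C] {n : ℕ} (r : R) (f : P.complex.X n ⟶ Y)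
    (m : ℕ) (hm : n + 1 = m) (hf : P.complex.d m n ≫ f = 0) :
    P.extMk (r • f) m hm (by simp [hf]) = r • P.extMk f m hm hf := by
  rw [Abelian.Ext.smul_eq_comp_mk₀, extMk_comp_mk₀]
  simp

open CochainComplex HomComplex in
lemma extMk_zero_eq_zero_iff (f : P.complex.X 0 ⟶ Y) (hf : P.complex.d 1 0 ≫ f = 0) :
    P.extMk f 1 rfl hf = 0 ↔ f = 0 := by
  simp only [← P.extEquivCohomologyClass.apply_eq_iff_eq,
    extEquivCohomologyClass_extMk, extEquivCohomologyClass_zero, CohomologyClass.mk_eq_zero_iff]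
  rw [Cocycle.toSingleMk_mem_coboundaries_iff _ _ _ _ _ 1 (by lia)]
  refine ⟨fun ⟨g, hg⟩ ↦ ?_, fun h ↦ ⟨0, by simp [h]⟩⟩
  have : P.cochainComplex.d (-(0 : ℕ)) 1 = 0 :=
    (P.cochainComplex.isZero_of_isStrictlyLE 0 1).eq_of_tgt _ _
  rw [this, zero_comp] at hg
  rw [← cancel_epi (P.cochainComplexXIso (-(0 : ℕ)) 0 rfl).hom]
  simpa using hg.symm

lemma extMk_eq_zero_iff_prev (n : ℕ) (f : P.complex.X n ⟶ Y)
    (hf : P.complex.d (n + 1) n ≫ f = 0) :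
    P.extMk f (n + 1) rfl hf = 0 ↔
      ∃ g : P.complex.X ((ComplexShape.up ℕ).prev n) ⟶ Y,
        P.complex.d n ((ComplexShape.up ℕ).prev n) ≫ g = f := by
  cases n with
  | zero =>
    rw [P.extMk_zero_eq_zero_iff, CochainComplex.prev_nat_zero]
    simp [eq_comm]
  | succ n => rw [P.extMk_eq_zero_iff _ _ _ _ n rfl, CochainComplex.prev_nat_succ]

end

variable (R : Type t) [Ring R] {C : Type u} [Category.{v} C] [Abelian C] [Linear R C] {X : C}
  (P : ProjectiveResolution X) (Y : C)

lemma d_comp_eq_zero_iff_mem_ker (n : ℕ) (f : P.complex.X n ⟶ Y) :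
    P.complex.d (n + 1) n ≫ f = 0 ↔
      f ∈ LinearMap.ker ((P.complex.linearYonedaObj R Y).sc n).g.hom := by
  change _ ↔ P.complex.d ((ComplexShape.up ℕ).next n) n ≫ f = 0
  rw [CochainComplex.next]

variable [HasExt.{w} C]

/-- The `R`-linear map sending an `n`-cocycle of `Hom(P, Y)` to its class in `Ext X Y n`. -/
noncomputable def cocyclesToExt (n : ℕ) :
    LinearMap.ker ((P.complex.linearYonedaObj R Y).sc n).g.hom →ₗ[R] Abelian.Ext X Y n where
  toFun f := P.extMk f.1 (n + 1) rfl ((P.d_comp_eq_zero_iff_mem_ker R Y n f.1).2 f.2)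
  map_add' _ _ := (P.add_extMk ..).symm
  map_smul' _ _ := P.extMk_smul ..

lemma cocyclesToExt_surjective (n : ℕ) : Function.Surjective (P.cocyclesToExt R Y n) := by
  intro α
  obtain ⟨f, hf, rfl⟩ := P.extMk_surjective α (n + 1) rfl
  exact ⟨⟨f, (P.d_comp_eq_zero_iff_mem_ker R Y n f).1 hf⟩, rfl⟩

lemma ker_cocyclesToExt (n : ℕ) :
    LinearMap.ker (P.cocyclesToExt R Y n) =
      LinearMap.range ((P.complex.linearYonedaObj R Y).sc n).moduleCatToCycles := by
  ext ⟨f, hf⟩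
  exact (P.extMk_eq_zero_iff_prev n f ((P.d_comp_eq_zero_iff_mem_ker R Y n f).2 hf)).trans
    (exists_congr fun _ ↦ ⟨fun h ↦ Subtype.ext h, fun h ↦ congrArg Subtype.val h⟩)

/-- The two definitions of `Ext`, as a derived functor of `Hom(-, Y)` and as morphisms in the
derived category, are linearly equivalent. -/
noncomputable def extLinearEquiv [EnoughProjectives C] (n : ℕ) :
    ((Ext R C n).obj (Opposite.op X)).obj Y ≃ₗ[R] Abelian.Ext X Y n :=
  (P.isoExt n Y ≪≫ ((P.complex.linearYonedaObj R Y).sc n).moduleCatHomologyIso).toLinearEquiv ≪≫ₗ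
    Submodule.quotEquivOfEq _ _ (P.ker_cocyclesToExt R Y n).symm ≪≫ₗ
    (P.cocyclesToExt R Y n).quotKerEquivOfSurjective (P.cocyclesToExt_surjective R Y n)

end CategoryTheory.ProjectiveResolution

section

open Abelian IsLocalRing RingTheory.Sequence

variable {R : Type u} [CommRing R]

namespace Ideal

/-- The short complex `R ⧸ K → R ⧸ I → R ⧸ (I + (x))` whose first map is multiplication by `x`. -/
noncomputable abbrev mulQuotientShortComplex (I K : Ideal R) (x : R) (h : ∀ r ∈ K, x * r ∈ I) :
    ShortComplex (ModuleCat.{u} R) :=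
  ModuleCat.shortComplexOfCompEqZero (Submodule.mapQ K I (LinearMap.lsmul R R x) h)
    (Submodule.factor (le_sup_left : I ≤ I ⊔ span {x})) (by
      ext
      exact (Submodule.Quotient.mk_eq_zero _).2
        (mem_sup_right (mul_mem_right _ _ (mem_span_singleton_self x))))

lemma mulQuotientShortComplex_shortExact (I K : Ideal R) (x : R) (h : ∀ r ∈ K, x * r ∈ I)
    (h' : ∀ r, x * r ∈ I → r ∈ K) : (mulQuotientShortComplex I K x h).ShortExact := by
  refine ModuleCat.shortComplex_shortExact _ (fun y ↦ ⟨fun hy ↦ ?_, ?_⟩) ?_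
    (Submodule.factor_surjective (le_sup_left : I ≤ I ⊔ span {x}))
  · obtain ⟨r, rfl⟩ := Submodule.mkQ_surjective _ y
    obtain ⟨a, ha, b, hb, hab⟩ := Submodule.mem_sup.1 ((Submodule.Quotient.mk_eq_zero _).1 hy)
    obtain ⟨c, rfl⟩ := mem_span_singleton.1 hb
    refine ⟨Submodule.Quotient.mk c, (Submodule.Quotient.eq I).2 ?_⟩
    convert I.neg_mem ha using 1
    have hr : a + x * c = r := hab
    rw [LinearMap.lsmul_apply, smul_eq_mul, ← hr]
    ring
  · rintro ⟨z, rfl⟩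
    exact LinearMap.congr_fun
      (ModuleCat.hom_ext_iff.1 (mulQuotientShortComplex I K x h).zero) z
  · refine (injective_iff_map_eq_zero _).2 fun z hz ↦ ?_
    obtain ⟨r, rfl⟩ := Submodule.mkQ_surjective _ z
    exact (Submodule.Quotient.mk_eq_zero _).2 (h' r ((Submodule.Quotient.mk_eq_zero _).1 hz))

end Ideal

namespace CategoryTheory.Abelian.Ext

lemma subsingleton_of_shortExact {C : Type*} [Category* C] [Abelian C] [HasExt C]
    {S : ShortComplex C} (hS : S.ShortExact) (Y : C) (n : ℕ) [Subsingleton (Ext S.X₁ Y n)]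
    [Subsingleton (Ext S.X₃ Y n)] : Subsingleton (Ext S.X₂ Y n) := by
  refine subsingleton_of_forall_eq 0 fun α ↦ ?_
  obtain ⟨β, rfl⟩ := contravariant_sequence_exact₂ hS Y α (Subsingleton.elim _ _)
  rw [Subsingleton.elim β 0, comp_zero]

lemma precompOfLinear_mk₀_surjective {C : Type*} [Category* C] [Abelian C] [HasExt C] [Linear R C]
    {S : ShortComplex C} (hS : S.ShortExact) (Y : C) (n : ℕ) [Subsingleton (Ext S.X₃ Y (n + 1))] :
    Function.Surjective ((mk₀ S.f).precompOfLinear R Y (zero_add n)) := fun α ↦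
  contravariant_sequence_exact₁ hS Y α (add_comm 1 n) (Subsingleton.elim _ _)

lemma smul_eq_mk₀_smul_id_comp {C : Type*} [Category* C] [Abelian C] [HasExt C] [Linear R C]
    {X Y : C} {n : ℕ} (r : R) (α : Ext X Y n) :
    r • α = (mk₀ (r • 𝟙 X)).comp α (zero_add n) := by
  rw [mk₀_smul, smul_comp, mk₀_id_comp]

end CategoryTheory.Abelian.Ext

namespace ModuleCat

lemma subsingleton_ext_of_smul_surjective [IsNoetherianRing R] [IsLocalRing R]
    (N M : ModuleCat.{u} R) [Module.Finite R N] [Module.Finite R M] {x : R}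
    (hx : x ∈ maximalIdeal R) (i : ℕ) (h : Function.Surjective fun α : Ext N M i ↦ x • α) :
    Subsingleton (Ext N M i) := by
  by_contra! ntr
  refine Submodule.top_ne_pointwise_smul_of_mem_jacobson_annihilator
    (IsLocalRing.maximalIdeal_le_jacobson (Module.annihilator R (Ext N M i)) hx)
    (top_le_iff.1 fun y _ ↦ ?_).symm
  obtain ⟨z, rfl⟩ := h y
  exact Submodule.smul_mem_pointwise_smul z x ⊤ trivial

/-- If `M` is finitely generated over a Noetherian local ring with residue field `k` and `Ext k M i`
vanishes for all `i ≥ e`, then so does `Ext (R ⧸ I) M i` for every ideal `I`. -/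
lemma subsingleton_ext_quotient_of_residueField [IsNoetherianRing R] [IsLocalRing R]
    (M : ModuleCat.{u} R) [Module.Finite R M] (e : ℕ)
    (h : ∀ i, e ≤ i → Subsingleton (Ext (of R (ResidueField R)) M i)) (I : Ideal R) :
    ∀ i, e ≤ i → Subsingleton (Ext (of R (R ⧸ I)) M i) := by
  induction I using WellFoundedGT.induction with | ind I ih => ?_
  intro i hi
  by_cases hI : maximalIdeal R ≤ I
  · by_cases hI' : I = ⊤
    · have : Subsingleton (R ⧸ I) := Submodule.Quotient.subsingleton_iff.2 hI'
      have := (isZero_of_subsingleton (of R (R ⧸ I))).hasProjectiveDimensionLT_zero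
      exact this.subsingleton _ 0 i i.zero_le M
    · obtain rfl := (maximalIdeal.isMaximal R).eq_of_le hI' hI
      exact h i hi
  · obtain ⟨x, hx, hxI⟩ := SetLike.not_le_iff_exists.1 hI
    have hJ : I < I ⊔ Ideal.span {x} := by
      simpa [Ideal.span_singleton_le_iff_mem] using hxI
    let K : Ideal R := Submodule.comap (LinearMap.lsmul R R x) I
    have hIK : I ≤ K := fun r hr ↦ I.mul_mem_left x hr
    have hS := I.mulQuotientShortComplex_shortExact K x (fun _ h ↦ h) (fun _ h ↦ h)
    rcases hIK.lt_or_eq with hlt | heq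
    · have : Subsingleton (Ext (I.mulQuotientShortComplex K x (fun _ h ↦ h)).X₁ M i) :=
        ih K hlt i hi
      have : Subsingleton (Ext (I.mulQuotientShortComplex K x (fun _ h ↦ h)).X₃ M i) :=
        ih _ hJ i hi
      exact Ext.subsingleton_of_shortExact hS M i
    · have hK (r : R) (hr : x * r ∈ I) : r ∈ I := heq ▸ (hr : r ∈ K)
      have hxI' (r : R) (hr : r ∈ I) : x * r ∈ I := I.mul_mem_left x hr
      have : Subsingleton (Ext (I.mulQuotientShortComplex I x hxI').X₃ M (i + 1)) :=
        ih _ hJ (i + 1) (by lia)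
      have surj := Ext.precompOfLinear_mk₀_surjective (R := R)
        (I.mulQuotientShortComplex_shortExact I x hxI' hK) M i
      refine subsingleton_ext_of_smul_surjective (of R (R ⧸ I)) M hx i fun α ↦ ?_
      obtain ⟨β, hβ⟩ := surj α
      have hf : (I.mulQuotientShortComplex I x hxI').f = x • 𝟙 (of R (R ⧸ I)) := by
        ext
        rfl
      refine ⟨β, (Ext.smul_eq_mk₀_smul_id_comp x β).trans (.trans ?_ hβ)⟩
      rw [← hf]
      rfl

lemma injective_of_subsingleton_ext_quotient (M : ModuleCat.{u} R)
    (h : ∀ I : Ideal R, Subsingleton (Ext (of R (R ⧸ I)) M 1)) : Injective M := by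
  rw [← Module.injective_iff_injective_object, ← Module.Baer.iff_injective]
  intro I f
  let S : ShortComplex (ModuleCat.{u} R) := shortComplexOfCompEqZero I.subtype I.mkQ (by
    ext r
    exact (Submodule.Quotient.mk_eq_zero I).2 r.2)
  have hS : S.ShortExact := shortComplex_shortExact S (LinearMap.exact_subtype_mkQ I)
    I.injective_subtype I.mkQ_surjective
  have : Subsingleton (Ext S.X₃ M (0 + 1)) := h I
  obtain ⟨α, hα⟩ := Ext.precompOfLinear_mk₀_surjective (R := R) hS M 0 (Ext.mk₀ (ofHom f))
  obtain ⟨g, rfl⟩ := (Ext.mk₀_bijective S.X₂ M).2 α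
  refine ⟨g.hom, fun r hr ↦ ?_⟩
  have hg : S.f ≫ g = ofHom f := (Ext.mk₀_bijective S.X₁ M).1 (by simpa using hα)
  exact LinearMap.congr_fun (ModuleCat.hom_ext_iff.1 hg) ⟨r, hr⟩

/-- A form of Baer's criterion for the injective dimension. -/
lemma hasInjectiveDimensionLE_of_subsingleton_ext_quotient (M : ModuleCat.{u} R) (d : ℕ)
    (h : ∀ I : Ideal R, Subsingleton (Ext (of R (R ⧸ I)) M (d + 1))) :
    HasInjectiveDimensionLE M d := by
  induction d generalizing M with
  | zero =>
    have := injective_of_subsingleton_ext_quotient M h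
    exact injective_iff_hasInjectiveDimensionLT_one.1 this
  | succ d ih =>
    obtain ⟨E, _, f, _⟩ := EnoughInjectives.presentation M
    have hS : (ShortComplex.mk f (Limits.cokernel.π f) (by simp)).ShortExact :=
      { exact := ShortComplex.exact_cokernel f }
    refine (hS.hasInjectiveDimensionLT_X₃_iff d inferInstance).1
      (ih (Limits.cokernel f) fun I ↦ subsingleton_of_forall_eq 0 fun α ↦ ?_)
    have := h I
    obtain ⟨β, rfl⟩ := Ext.covariant_sequence_exact₃ _ hS α rfl (Subsingleton.elim _ _)
    rw [Ext.eq_zero_of_injective β, Ext.zero_comp]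

lemma exists_surjective_ext_of_linearEquiv {M N : ModuleCat.{u} R} (e : M ≃ₗ[R] N)
    (Y : ModuleCat.{u} R) (n : ℕ) (h : ∃ φ : R →ₗ[R] Ext N Y n, Function.Surjective φ) :
    ∃ φ : R →ₗ[R] Ext M Y n, Function.Surjective φ := by
  obtain ⟨φ, hφ⟩ := h
  refine ⟨(Ext.mk₀ e.toModuleIso.hom).precompOfLinear R Y (zero_add n) ∘ₗ φ,
    Function.Surjective.comp (g := (Ext.mk₀ e.toModuleIso.hom).precompOfLinear R Y (zero_add n))
      (fun α ↦ ⟨(Ext.mk₀ e.toModuleIso.inv).comp α (zero_add n), ?_⟩) hφ⟩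
  refine (Ext.mk₀_comp_mk₀_assoc ..).trans ?_
  rw [e.toModuleIso.hom_inv_id]
  exact Ext.mk₀_id_comp α

/-- If `Ext M Y n` is cyclic and `M` has projective dimension at most `n`, the same holds for the
quotient of `M` by a regular sequence, after increasing `n` by the length of the sequence. -/
lemma exists_surjective_ext_quotient_of_isWeaklyRegular (M Y : ModuleCat.{u} R) (n m : ℕ)
    [HasProjectiveDimensionLE M n]
    (h : ∃ φ : R →ₗ[R] Ext M Y n, Function.Surjective φ) (rs : List R)
    (reg : IsWeaklyRegular M rs) (hm : n + rs.length = m) :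
    HasProjectiveDimensionLE (of R (M ⧸ (Ideal.ofList rs • ⊤ : Submodule R M))) m ∧
      ∃ φ : R →ₗ[R] Ext (of R (M ⧸ (Ideal.ofList rs • ⊤ : Submodule R M))) Y m,
        Function.Surjective φ := by
  induction rs generalizing M n with
  | nil =>
    obtain rfl : n = m := hm
    let e : of R (M ⧸ (Ideal.ofList ([] : List R) • ⊤ : Submodule R M)) ≃ₗ[R] M :=
      Submodule.quotEquivOfEqBot _ (by rw [Ideal.ofList_nil, Submodule.bot_smul])
    exact ⟨hasProjectiveDimensionLT_of_iso e.toModuleIso.symm _,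
      exists_surjective_ext_of_linearEquiv e Y n h⟩
  | cons x rs ih =>
    rw [isWeaklyRegular_cons_iff] at reg
    have hS := reg.1.smulShortComplex_shortExact
    have : HasProjectiveDimensionLE (of R (QuotSMulTop x M)) (n + 1) :=
      hS.hasProjectiveDimensionLT_X₃ (n + 1) ‹HasProjectiveDimensionLE M n›
        (hasProjectiveDimensionLT_of_ge M (n + 1) (n + 1 + 1) (by lia))
    have h' : ∃ φ : R →ₗ[R] Ext (of R (QuotSMulTop x M)) Y (n + 1), Function.Surjective φ := by
      obtain ⟨φ, hφ⟩ := h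
      have : Subsingleton (Ext (M.smulShortComplex x).X₂ Y (n + 1)) :=
        HasProjectiveDimensionLT.subsingleton M (n + 1) (n + 1) le_rfl Y
      exact ⟨hS.extClass.precompOfLinear R Y (add_comm 1 n) ∘ₗ φ,
        Function.Surjective.comp (g := hS.extClass.precompOfLinear R Y (add_comm 1 n)) (fun α ↦
        Ext.contravariant_sequence_exact₃ hS Y α (Subsingleton.elim _ _) (add_comm 1 n)) hφ⟩
    obtain ⟨h₁, h₂⟩ := ih (of R (QuotSMulTop x M)) (n + 1) h' reg.2 (by grind)
    let e : of R (M ⧸ (Ideal.ofList (x :: rs) • ⊤ : Submodule R M)) ≃ₗ[R]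
        of R (QuotSMulTop x M ⧸ (Ideal.ofList rs • ⊤ : Submodule R (QuotSMulTop x M))) :=
      Submodule.quotOfListConsSMulTopEquivQuotSMulTopInner M x rs
    exact ⟨hasProjectiveDimensionLT_of_iso e.toModuleIso.symm _,
      exists_surjective_ext_of_linearEquiv e Y m h₂⟩

lemma smul_ext_eq_zero_of_mem_annihilator {N M : ModuleCat.{u} R} {n : ℕ} {r : R}
    (hr : r ∈ Module.annihilator R N) (α : Ext N M n) : r • α = 0 := by
  have : r • 𝟙 N = 0 := by
    ext y
    exact Module.mem_annihilator.1 hr y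
  rw [Ext.smul_eq_mk₀_smul_id_comp, this, Ext.mk₀_zero, Ext.zero_comp]

variable [IsLocalRing R]

lemma ker_eq_maximalIdeal {M : Type*} [AddCommGroup M] [Module R M] {f : R →ₗ[R] M}
    (hf : f ≠ 0) (h : ∀ r ∈ maximalIdeal R, f r = 0) : LinearMap.ker f = maximalIdeal R :=
  ((maximalIdeal.isMaximal R).eq_of_le (fun hker ↦ hf (LinearMap.ker_eq_top.1 hker)) h).symm

lemma annihilator_residueField : Module.annihilator R (ResidueField R) = maximalIdeal R :=
  Ideal.annihilator_quotient

variable [IsNoetherianRing R]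

/-- If `Ext k R i` vanishes for `i < t` but not for `i = t`, there is an `R`-regular sequence
`rs` of length `t` such that `k` embeds into `R ⧸ (rs)`. -/
lemma exists_isRegular_of_nontrivial_ext (t : ℕ)
    (h : ∀ i < t, Subsingleton (Ext (of R (ResidueField R)) (of R R) i))
    (ht : Nontrivial (Ext (of R (ResidueField R)) (of R R) t)) :
    ∃ rs : List R, rs.length = t ∧ IsRegular R rs ∧
      ∃ a, ∀ r, a * r ∈ (Ideal.ofList rs • ⊤ : Ideal R) ↔ r ∈ maximalIdeal R := by
  have lt : maximalIdeal R • (⊤ : Submodule R (of R R)) < ⊤ := by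
    simpa using (maximalIdeal.isMaximal R).ne_top.lt_top
  have supp : Module.support R (ResidueField R) = PrimeSpectrum.zeroLocus (maximalIdeal R) := by
    rw [Module.support_eq_zeroLocus, annihilator_residueField]
  obtain ⟨rs, rfl, hrs, reg⟩ := exists_isRegular_of_exists_subsingleton_ext (maximalIdeal R) t
    (of R R) lt (of R (ResidueField R)) supp h
  refine ⟨rs, rfl, reg, ?_⟩
  let S := R ⧸ (Ideal.ofList rs • ⊤ : Ideal R)
  have : Nontrivial (ResidueField R →ₗ[R] S) := by
    by_contra! hsub
    obtain ⟨y, hy, hy'⟩ := IsSMulRegular.subsingleton_linearMap_iff.1 hsub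
    rw [annihilator_residueField] at hy
    have mem : ∀ r ∈ rs ++ [y], r ∈ maximalIdeal R := by
      simpa [or_imp, forall_and] using ⟨hrs, hy⟩
    have reg' : IsRegular R (rs ++ [y]) :=
      (isRegular_iff_isWeaklyRegular_of_subset_maximalIdeal mem).2
        ((isWeaklyRegular_append_iff R rs [y]).2
          ⟨reg.1, (isWeaklyRegular_singleton_iff _ y).2 hy'⟩)
    have := subsingleton_ext_of_exists_isRegular (maximalIdeal R) (of R (ResidueField R))
      supp.subset (of R R) lt (rs ++ [y]) mem reg' rs.length (by simp)
    exact not_subsingleton _ this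
  obtain ⟨f, hf⟩ := exists_ne (0 : ResidueField R →ₗ[R] S)
  have hker : LinearMap.ker (f ∘ₗ Algebra.linearMap R (ResidueField R)) = maximalIdeal R := by
    refine ker_eq_maximalIdeal (fun h ↦ hf ?_) fun r hr ↦ ?_
    · ext y
      obtain ⟨r, rfl⟩ := residue_surjective y
      exact LinearMap.congr_fun h r
    · rw [LinearMap.comp_apply, Algebra.linearMap_apply, ResidueField.algebraMap_eq,
        (residue_eq_zero_iff r).2 hr, map_zero]
  obtain ⟨a, ha⟩ := Submodule.mkQ_surjective _ (f 1)
  refine ⟨a, fun r ↦ ?_⟩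
  have hr : (Ideal.ofList rs • ⊤ : Ideal R).mkQ (a * r) = f (algebraMap R _ r) := by
    rw [mul_comm, ← smul_eq_mul, map_smul, ha, ← map_smul, Algebra.algebraMap_eq_smul_one]
  rw [← hker, LinearMap.mem_ker, LinearMap.comp_apply, Algebra.linearMap_apply, ← hr,
    Submodule.mkQ_apply, Submodule.Quotient.mk_eq_zero]

/-- If a Noetherian local ring `R` with residue field `k` has finite injective dimension over
itself, then `Ext k R i` is isomorphic to `k` for one value of `i` and vanishes for all others. -/
lemma exists_ext_residueField_concentrated (n : ℕ) [HasInjectiveDimensionLE (of R R) n] :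
    ∃ d : ℕ, (∀ i ≠ d, Subsingleton (Ext (of R (ResidueField R)) (of R R) i)) ∧
      Nonempty (Ext (of R (ResidueField R)) (of R R) d ≃ₗ[R] ResidueField R) := by
  have hex : ∃ t, Nontrivial (Ext (of R (ResidueField R)) (of R R) t) := by
    by_contra! hsub
    have := subsingleton_ext_quotient_of_residueField (of R R) 0 (fun i _ ↦ hsub i) ⊥ 0 le_rfl
    have : Subsingleton ((R ⧸ (⊥ : Ideal R)) →ₗ[R] R) :=
      (Ext.addEquiv₀.trans (homAddEquiv (M := of R (R ⧸ (⊥ : Ideal R)))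
        (N := of R R))).symm.subsingleton
    exact one_ne_zero (LinearMap.congr_fun
      (Subsingleton.elim (Submodule.quotEquivOfEqBot (⊥ : Ideal R) rfl).toLinearMap 0)
      (Submodule.Quotient.mk 1))
  classical
  let t := Nat.find hex
  have ht : Nontrivial (Ext (of R (ResidueField R)) (of R R) t) := Nat.find_spec hex
  have hlt (i : ℕ) (hi : i < t) : Subsingleton (Ext (of R (ResidueField R)) (of R R) i) :=
    not_nontrivial_iff_subsingleton.1 (Nat.find_min hex hi)
  obtain ⟨rs, hlen, reg, a, ha⟩ := exists_isRegular_of_nontrivial_ext t hlt ht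
  clear_value t
  obtain ⟨hpd, φ, hφ⟩ := exists_surjective_ext_quotient_of_isWeaklyRegular (of R R) (of R R) 0 t
    ⟨(Ext.linearEquiv₀ ≪≫ₗ homLinearEquiv ≪≫ₗ LinearMap.ringLmapEquivSelf R R R).symm.toLinearMap,
      LinearEquiv.surjective _⟩ rs reg.1 (by simpa using hlen)
  have hS := Ideal.mulQuotientShortComplex_shortExact (Ideal.ofList rs • ⊤) (maximalIdeal R) a
    (fun r hr ↦ (ha r).2 hr) (fun r hr ↦ (ha r).1 hr)
  set S := Ideal.mulQuotientShortComplex (Ideal.ofList rs • ⊤) (maximalIdeal R) a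
    (fun r hr ↦ (ha r).2 hr)
  have key (e : ℕ) (he : t + 1 ≤ e)
      (h : ∀ i, e + 1 ≤ i → Subsingleton (Ext (of R (ResidueField R)) (of R R) i)) :
      ∀ i, e ≤ i → Subsingleton (Ext (of R (ResidueField R)) (of R R) i) := by
    intro i hi
    have : Subsingleton (Ext S.X₃ (of R R) (i + 1)) :=
      subsingleton_ext_quotient_of_residueField (of R R) (e + 1) h _ (i + 1) (by lia)
    have : Subsingleton (Ext S.X₂ (of R R) i) :=
      HasProjectiveDimensionLT.subsingleton _ (t + 1) i (by lia) _
    exact (Ext.precompOfLinear_mk₀_surjective (R := R) hS (of R R) i).subsingleton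
  have hgt : ∀ i, t + 1 ≤ i → Subsingleton (Ext (of R (ResidueField R)) (of R R) i) := by
    refine Nat.decreasingInduction'
      (P := fun e ↦ ∀ i, e ≤ i → Subsingleton (Ext (of R (ResidueField R)) (of R R) i))
      (fun e _ he ih ↦ key e he ih) (show t + 1 ≤ t + 1 + n by lia) fun i hi ↦ ?_
    exact HasInjectiveDimensionLT.subsingleton (of R R) (n + 1) i (by lia) _
  refine ⟨t, fun i hi ↦ (lt_or_gt_of_ne hi).elim (hlt i) (hgt i), ?_⟩
  have : Subsingleton (Ext S.X₃ (of R R) (t + 1)) :=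
    subsingleton_ext_quotient_of_residueField (of R R) (t + 1) hgt _ (t + 1) le_rfl
  let ψ : R →ₗ[R] Ext (of R (ResidueField R)) (of R R) t :=
    (Ext.mk₀ S.f).precompOfLinear R (of R R) (zero_add t) ∘ₗ φ
  have hψ : Function.Surjective ψ :=
    Function.Surjective.comp (g := (Ext.mk₀ S.f).precompOfLinear R (of R R) (zero_add t))
      (Ext.precompOfLinear_mk₀_surjective (R := R) hS (of R R) t) hφ
  have hker : LinearMap.ker ψ = maximalIdeal R := by
    refine ker_eq_maximalIdeal (fun h ↦ ?_) fun r hr ↦ ?_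
    · obtain ⟨α, hα⟩ := exists_ne (0 : Ext (of R (ResidueField R)) (of R R) t)
      obtain ⟨r, rfl⟩ := hψ α
      exact hα (LinearMap.congr_fun h r)
    · rw [← mul_one r, ← smul_eq_mul, map_smul]
      exact smul_ext_eq_zero_of_mem_annihilator (annihilator_residueField (R := R) ▸ hr) _
  exact ⟨(Submodule.quotEquivOfEq _ _ hker.symm ≪≫ₗ ψ.quotKerEquivOfSurjective hψ).symm⟩

end ModuleCat
end

/-- `extRMod` is linearly equivalent to the `Ext` group in the derived category. -/
noncomputable def extRModEquiv {R : Type} [CommRing R] (M N : ModuleCat R) (n : ℕ) :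
    extRMod R M N n ≃ₗ[R] Abelian.Ext M N n :=
  (projectiveResolution M).extLinearEquiv R N n

lemma extVanish_iff {R : Type} [CommRing R] (M N : ModuleCat R) (n : ℕ) :
    extVanish R M N n ↔ Subsingleton (Abelian.Ext M N n) :=
  (extRModEquiv M N n).toEquiv.subsingleton_congr

theorem gorenstein_iff_ext_residueField_concentrated
    (R : Type) [CommRing R] [IsNoetherianRing R] [IsLocalRing R] :
    IsGorensteinRing R ↔
      ∃ d : ℕ,
        (∀ i : ℕ, i ≠ d →
          extVanish R (ModuleCat.of R (IsLocalRing.ResidueField R)) (ModuleCat.of R R) i) ∧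
        Nonempty
          ((extRMod R (ModuleCat.of R (IsLocalRing.ResidueField R)) (ModuleCat.of R R) d)
            ≃ₗ[R] IsLocalRing.ResidueField R) := by
  constructor
  · rintro ⟨n, hn⟩
    have : HasInjectiveDimensionLE (ModuleCat.of R R) n :=
      ModuleCat.hasInjectiveDimensionLE_of_subsingleton_ext_quotient _ n fun I ↦
        (extVanish_iff ..).1 (hn (ModuleCat.of R (R ⧸ I)) (n + 1) n.lt_succ_self)
    obtain ⟨d, hd, ⟨e⟩⟩ := ModuleCat.exists_ext_residueField_concentrated (R := R) n
    exact ⟨d, fun i hi ↦ (extVanish_iff ..).2 (hd i hi), ⟨extRModEquiv _ _ d ≪≫ₗ e⟩⟩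
  · rintro ⟨d, hd, -⟩
    have : HasInjectiveDimensionLE (ModuleCat.of R R) d :=
      ModuleCat.hasInjectiveDimensionLE_of_subsingleton_ext_quotient _ d fun I ↦
        ModuleCat.subsingleton_ext_quotient_of_residueField _ (d + 1)
          (fun i hi ↦ (extVanish_iff ..).1 (hd i (by lia))) I (d + 1) le_rfl
    exact ⟨d, fun N i hi ↦ (extVanish_iff ..).2
      (HasInjectiveDimensionLT.subsingleton _ (d + 1) i hi N)⟩
end

section
/- Let R be a commutative Noetherian local ring. R is Gorenstein if and only if every finitely generated R-module has finite Gorenstein dimension. -/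
/-!
STATEMENT 6: Let `R` be a commutative Noetherian local ring.  `R` is Gorenstein if and only
if every finitely generated `R`-module has finite Gorenstein dimension (i.e. admits a finite
resolution by totally reflexive modules).
-/

open CategoryTheory

/-- A finitely generated module `G` is totally reflexive (Gorenstein projective) if the
biduality map `G → G**` is bijective and `Ext^i_R(G,R) = Ext^i_R(G*,R) = 0` for all `i > 0`. -/
def TotallyReflexive (R : Type) [CommRing R] (G : ModuleCat R) : Prop :=
  Module.Finite R G ∧
  Function.Bijective (Module.Dual.eval R G) ∧
  (∀ i : ℕ, 0 < i →
    extVanish R G (ModuleCat.of R R) i ∧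
    extVanish R (ModuleCat.of R (Module.Dual R G)) (ModuleCat.of R R) i)

/-- `GdimLE R n M` : `M` admits a resolution of length at most `n` by totally reflexive
modules, i.e. the Gorenstein dimension of `M` is at most `n`. -/
def GdimLE (R : Type) [CommRing R] : ℕ → ModuleCat R → Prop
  | 0, M => TotallyReflexive R M
  | n + 1, M => TotallyReflexive R M ∨
      ∃ (G : ModuleCat R) (f : G ⟶ M), Epi f ∧ TotallyReflexive R G ∧
        GdimLE R n (Limits.kernel f)

/-- The vanishing of the derived functor `Ext` agrees with that of `Abelian.Ext`. -/
theorem extVanish_succ_iff (R : Type) [CommRing R] (M N : ModuleCat R) (n : ℕ) :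
    extVanish R M N (n + 1) ↔ Subsingleton (Abelian.Ext.{0} M N (n + 1)) := by
  let P : ProjectiveResolution M := ProjectiveResolution.of M
  unfold extVanish extRMod
  rw [(P.isoExt (R := R) (n + 1) N).toLinearEquiv.toEquiv.subsingleton_congr,
    ← ModuleCat.isZero_iff_subsingleton, ← HomologicalComplex.exactAt_iff_isZero_homology,
    HomologicalComplex.exactAt_iff' _ n (n + 1) (n + 2) (by simp) (by simp),
    ShortComplex.moduleCat_exact_iff]
  constructor
  · intro h
    refine subsingleton_of_forall_eq 0 fun α => ?_
    obtain ⟨f, hf, rfl⟩ := P.extMk_surjective α (n + 2) rfl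
    rw [P.extMk_eq_zero_iff f _ _ hf n rfl]
    exact h f hf
  · intro h f hf
    exact (P.extMk_eq_zero_iff f (n + 2) rfl hf n rfl).1 (Subsingleton.elim _ _)

section ShortExact

variable {C : Type*} [Category* C] [Abelian C] [HasExt C] {S : ShortComplex C}

lemma CategoryTheory.ShortComplex.ShortExact.subsingleton_ext_X₃ (hS : S.ShortExact) (Y : C)
    (n : ℕ) (h₁ : Subsingleton (Abelian.Ext S.X₁ Y n))
    (h₂ : Subsingleton (Abelian.Ext S.X₂ Y (n + 1))) :
    Subsingleton (Abelian.Ext S.X₃ Y (n + 1)) := by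
  refine subsingleton_of_forall_eq 0 fun x => ?_
  obtain ⟨y, rfl⟩ := Abelian.Ext.contravariant_sequence_exact₃ hS Y x (Subsingleton.elim _ _)
    (add_comm 1 n)
  simp [Subsingleton.elim y 0]

lemma CategoryTheory.ShortComplex.ShortExact.subsingleton_ext_X₁ (hS : S.ShortExact) (Y : C)
    (n : ℕ) (h₂ : Subsingleton (Abelian.Ext S.X₂ Y n))
    (h₃ : Subsingleton (Abelian.Ext S.X₃ Y (n + 1))) :
    Subsingleton (Abelian.Ext S.X₁ Y n) := by
  refine subsingleton_of_forall_eq 0 fun x => ?_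
  obtain ⟨y, rfl⟩ := Abelian.Ext.contravariant_sequence_exact₁ hS Y x (add_comm 1 n)
    (Subsingleton.elim _ _)
  simp [Subsingleton.elim y 0]

lemma CategoryTheory.ShortComplex.ShortExact.subsingleton_ext_X₂ (hS : S.ShortExact) (Y : C)
    (n : ℕ) (h₁ : Subsingleton (Abelian.Ext S.X₁ Y n))
    (h₃ : Subsingleton (Abelian.Ext S.X₃ Y n)) :
    Subsingleton (Abelian.Ext S.X₂ Y n) := by
  refine subsingleton_of_forall_eq 0 fun x => ?_
  obtain ⟨y, rfl⟩ := Abelian.Ext.contravariant_sequence_exact₂ hS Y x (Subsingleton.elim _ _)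
  simp [Subsingleton.elim y 0]

/-- If `Ext¹(S.X₃, Y) = 0`, every morphism `S.X₁ ⟶ Y` extends to `S.X₂`. -/
lemma CategoryTheory.ShortComplex.ShortExact.exists_extension (hS : S.ShortExact) (Y : C)
    (h₃ : Subsingleton (Abelian.Ext S.X₃ Y 1)) (φ : S.X₁ ⟶ Y) :
    ∃ ψ : S.X₂ ⟶ Y, S.f ≫ ψ = φ := by
  obtain ⟨y, hy⟩ := Abelian.Ext.contravariant_sequence_exact₁ hS Y (Abelian.Ext.mk₀ φ)
    (add_zero 1) (Subsingleton.elim _ _)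
  obtain ⟨ψ, rfl⟩ := (Abelian.Ext.mk₀_bijective _ _).2 y
  rw [Abelian.Ext.mk₀_comp_mk₀] at hy
  exact ⟨ψ, (Abelian.Ext.mk₀_bijective _ _).1 hy⟩

lemma CategoryTheory.Iso.subsingleton_ext_iff {X X' : C} (e : X ≅ X') (Y : C) (n : ℕ) :
    Subsingleton (Abelian.Ext X Y n) ↔ Subsingleton (Abelian.Ext X' Y n) := by
  suffices ∀ {X X' : C}, (X ≅ X') → Subsingleton (Abelian.Ext X Y n) →
      Subsingleton (Abelian.Ext X' Y n) from ⟨this e, this e.symm⟩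
  intro X X' e h
  refine subsingleton_of_forall_eq 0 fun x => ?_
  have : x = (Abelian.Ext.mk₀ e.inv).comp ((Abelian.Ext.mk₀ e.hom).comp x (zero_add n))
      (zero_add n) := by simp
  rw [this, Subsingleton.elim ((Abelian.Ext.mk₀ e.hom).comp x (zero_add n)) 0]
  simp

end ShortExact

section InjectiveDimension

variable {R : Type} [CommRing R]

/-- **Baer's criterion** in terms of `Ext¹`. -/
lemma ModuleCat.injective_of_subsingleton_ext_one (M : ModuleCat.{0} R)
    (h : ∀ I : Ideal R, Subsingleton (Abelian.Ext.{0} (ModuleCat.of R (R ⧸ I)) M 1)) :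
    Injective M := by
  rw [← Module.injective_iff_injective_object, ← Module.Baer.iff_injective]
  intro I g
  let S : ShortComplex (ModuleCat.{0} R) :=
    ModuleCat.shortComplexOfCompEqZero I.subtype (Submodule.mkQ I)
      (LinearMap.exact_subtype_mkQ I).linearMap_comp_eq_zero
  have hS : S.ShortExact := ModuleCat.shortComplex_shortExact S
    (LinearMap.exact_subtype_mkQ I) (Submodule.injective_subtype I) (Submodule.mkQ_surjective I)
  obtain ⟨ψ, hψ⟩ := hS.exists_extension M (h I) (ModuleCat.ofHom g)
  exact ⟨ψ.hom, fun x mem => congr($hψ ⟨x, mem⟩)⟩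

lemma ModuleCat.hasInjectiveDimensionLE_of_subsingleton_ext (M : ModuleCat.{0} R) (n : ℕ)
    (h : ∀ I : Ideal R, Subsingleton (Abelian.Ext.{0} (ModuleCat.of R (R ⧸ I)) M (n + 1))) :
    HasInjectiveDimensionLE M n := by
  induction n generalizing M with
  | zero =>
    have := ModuleCat.injective_of_subsingleton_ext_one M h
    exact injective_iff_hasInjectiveDimensionLT_one.1 this
  | succ n ih =>
    let ⟨J, _, f, _⟩ := EnoughInjectives.presentation M
    have hS : (ShortComplex.mk f (Limits.cokernel.π f) (by simp)).ShortExact :=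
      { exact := ShortComplex.exact_cokernel f }
    refine (hS.hasInjectiveDimensionLT_X₃_iff n inferInstance).1 (ih _ fun I => ?_)
    refine subsingleton_of_forall_eq 0 fun x => ?_
    have := h I
    obtain ⟨y, rfl⟩ := Abelian.Ext.covariant_sequence_exact₃ _ hS x rfl (Subsingleton.elim _ _)
    rw [y.eq_zero_of_injective]
    simp

end InjectiveDimension

section LocalRing

variable {R : Type} [CommRing R] [IsNoetherianRing R]

lemma ModuleCat.subsingleton_ext_of_forall_prime (M : ModuleCat.{0} R) (i : ℕ) (I : Ideal R)
    (h : ∀ p : PrimeSpectrum R, I ≤ p.asIdeal →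
      Subsingleton (Abelian.Ext.{0} (ModuleCat.of R (R ⧸ p.asIdeal)) M i))
    (N : Type) [AddCommGroup N] [Module R N] [hN : Module.Finite R N]
    (hI : I ≤ Module.annihilator R N) :
    Subsingleton (Abelian.Ext.{0} (ModuleCat.of R N) M i) := by
  induction hN using IsNoetherianRing.induction_on_isQuotientEquivQuotientPrime R with
  | subsingleton N =>
    have : (Limits.IsZero (ModuleCat.of R N)) := ModuleCat.isZero_of_subsingleton _
    refine subsingleton_of_forall_eq 0 fun x => ?_
    rw [← Abelian.Ext.mk₀_id_comp x, this.eq_of_src (𝟙 _) 0]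
    simp
  | quotient N p e =>
    refine (e.toModuleIso.subsingleton_ext_iff M i).2 (h p ?_)
    rw [e.annihilator_eq, Ideal.annihilator_quotient] at hI
    exact hI
  | exact N₁ N₂ N₃ f g hf hg hfg h₁ h₃ =>
    exact (ModuleCat.shortComplex_shortExact (ModuleCat.shortComplexOfCompEqZero f g
      hfg.linearMap_comp_eq_zero) hfg hf hg).subsingleton_ext_X₂ M i
      (h₁ (hI.trans (f.annihilator_le_of_injective hf)))
      (h₃ (hI.trans (g.annihilator_le_of_surjective hg)))

variable [IsLocalRing R]

lemma ModuleCat.subsingleton_ext_of_residueField (M : ModuleCat.{0} R) [Module.Finite R M] (n : ℕ)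
    (h : ∀ i, n < i →
      Subsingleton (Abelian.Ext.{0} (ModuleCat.of R (R ⧸ IsLocalRing.maximalIdeal R)) M i))
    (p : PrimeSpectrum R) (i : ℕ) (hi : n < i) :
    Subsingleton (Abelian.Ext.{0} (ModuleCat.of R (R ⧸ p.asIdeal)) M i) := by
  have : WellFoundedGT (PrimeSpectrum R) :=
    StrictMono.wellFoundedGT (f := PrimeSpectrum.asIdeal) fun _ _ hlt => hlt
  induction p using WellFoundedGT.induction generalizing i with
  | ind p ih =>
  by_cases hp : p.asIdeal = IsLocalRing.maximalIdeal R
  · rw [hp]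
    exact h i hi
  obtain ⟨x, hx, hxp⟩ := SetLike.exists_of_lt
    (lt_of_le_of_ne (IsLocalRing.le_maximalIdeal p.isPrime.ne_top) hp)
  let f := LinearMap.lsmul R (R ⧸ p.asIdeal) x
  have hf : Function.Injective f := by
    rw [injective_iff_map_eq_zero]
    intro a ha
    obtain ⟨a, rfl⟩ := Ideal.Quotient.mk_surjective a
    have : Ideal.Quotient.mk p.asIdeal (x * a) = 0 := ha
    rw [Ideal.Quotient.eq_zero_iff_mem] at this ⊢
    exact (p.isPrime.mem_or_mem this).resolve_left hxp
  let S := ModuleCat.shortComplexOfCompEqZero f f.range.mkQ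
    f.exact_map_mkQ_range.linearMap_comp_eq_zero
  have hS : S.ShortExact := ModuleCat.shortComplex_shortExact S
    f.exact_map_mkQ_range hf (Submodule.mkQ_surjective _)
  have h₃ : Subsingleton (Abelian.Ext.{0} S.X₃ M (i + 1)) := by
    refine ModuleCat.subsingleton_ext_of_forall_prime M (i + 1) (p.asIdeal ⊔ Ideal.span {x})
      (fun q hq => ?_) _ ?_
    · refine ih q (lt_of_le_of_ne (le_sup_left.trans hq) ?_) (i + 1) (by omega)
      rintro rfl
      exact hxp (hq (Ideal.mem_sup_right (Ideal.mem_span_singleton_self x)))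
    · refine sup_le ?_ ?_
      · refine le_trans ?_ (f.range.mkQ.annihilator_le_of_surjective (Submodule.mkQ_surjective _))
        rw [Ideal.annihilator_quotient]
      · rw [Ideal.span_singleton_le_iff_mem, Module.mem_annihilator]
        intro y
        obtain ⟨y, rfl⟩ := Submodule.mkQ_surjective _ y
        rw [← map_smul, Submodule.mkQ_apply, Submodule.Quotient.mk_eq_zero]
        exact ⟨y, rfl⟩
  rw [← Submodule.subsingleton_iff R, ← subsingleton_iff_bot_eq_top, eq_comm]
  refine Submodule.eq_bot_of_le_smul_of_le_jacobson_bot (Ideal.span {x}) ⊤ Module.Finite.fg_top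
    (fun y _ => ?_) ?_
  · obtain ⟨z, hz⟩ := Abelian.Ext.contravariant_sequence_exact₁ hS M y (add_comm 1 i)
      (Subsingleton.elim _ _)
    have hfx : S.f = x • 𝟙 _ := rfl
    rw [hfx, Abelian.Ext.mk₀_smul, Abelian.Ext.smul_comp] at hz
    have hz' : x • z = y := by simpa using hz
    rw [← hz']
    exact Submodule.smul_mem_smul (Ideal.mem_span_singleton_self x) trivial
  · rw [IsLocalRing.jacobson_eq_maximalIdeal _ bot_ne_top, Ideal.span_singleton_le_iff_mem]
    exact hx

/-- A finitely generated module over a Noetherian local ring has injective dimension at most `n`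
if its `Ext` modules from the residue field vanish above `n`. -/
lemma ModuleCat.hasInjectiveDimensionLE_of_residueField (M : ModuleCat.{0} R) [Module.Finite R M]
    (n : ℕ)
    (h : ∀ i, n < i →
      Subsingleton (Abelian.Ext.{0} (ModuleCat.of R (R ⧸ IsLocalRing.maximalIdeal R)) M i)) :
    HasInjectiveDimensionLE M n :=
  ModuleCat.hasInjectiveDimensionLE_of_subsingleton_ext M n fun _ =>
    ModuleCat.subsingleton_ext_of_forall_prime M (n + 1) ⊥
      (fun p _ => ModuleCat.subsingleton_ext_of_residueField M n h p (n + 1) n.lt_succ_self)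
      _ bot_le

end LocalRing

section TotallyReflexive

variable {R : Type} [CommRing R]

lemma shortExact_dual_of_subsingleton_ext_one {F G : Type} [AddCommGroup F] [Module R F]
    [AddCommGroup G] [Module R G] {f : F →ₗ[R] G} (hf : Function.Surjective f)
    (hG : Subsingleton (Abelian.Ext.{0} (ModuleCat.of R G) (ModuleCat.of R R) 1)) :
    (ModuleCat.shortComplexOfCompEqZero f.dualMap f.ker.subtype.dualMap
      (by ext; simp)).ShortExact := by
  refine ModuleCat.shortComplex_shortExact _ (fun φ => ⟨fun hφ => ?_, ?_⟩)
    (LinearMap.dualMap_injective_of_surjective hf) fun φ => ?_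
  · have hφ' : φ ∈ f.ker.dualAnnihilator := by
      rw [Submodule.mem_dualAnnihilator]
      exact fun w hw => congr($hφ ⟨w, hw⟩)
    rwa [← LinearMap.range_dualMap_eq_dualAnnihilator_ker_of_surjective f hf] at hφ'
  · rintro ⟨ψ, rfl⟩
    ext
    simp
  · obtain ⟨ψ, hψ⟩ := (LinearMap.shortExact_shortComplexKer hf).exists_extension _ hG
      (ModuleCat.ofHom φ)
    exact ⟨ψ.hom, congr(ModuleCat.Hom.hom $hψ)⟩

lemma subsingleton_ext_ker {F G : Type} [AddCommGroup F] [Module R F] [Module.Free R F]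
    [AddCommGroup G] [Module R G] {f : F →ₗ[R] G} (hf : Function.Surjective f)
    (M : ModuleCat.{0} R) (i : ℕ)
    (hG : Subsingleton (Abelian.Ext.{0} (ModuleCat.of R G) M (i + 2))) :
    Subsingleton (Abelian.Ext.{0} (ModuleCat.of R f.ker) M (i + 1)) :=
  (LinearMap.shortExact_shortComplexKer hf).subsingleton_ext_X₁ M (i + 1)
    (Abelian.Ext.subsingleton_of_projective (ModuleCat.of R F) M i) hG

lemma subsingleton_ext_of_gdimLE (d : ℕ) (M : ModuleCat.{0} R) (hM : GdimLE R d M) (i : ℕ)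
    (hi : d ≤ i) : Subsingleton (Abelian.Ext.{0} M (ModuleCat.of R R) (i + 1)) := by
  have of_refl {G : ModuleCat.{0} R} (hG : TotallyReflexive R G) (i : ℕ) :
      Subsingleton (Abelian.Ext.{0} G (ModuleCat.of R R) (i + 1)) :=
    (extVanish_succ_iff R G _ i).1 (hG.2.2 (i + 1) i.succ_pos).1
  induction d generalizing M i with
  | zero => exact of_refl hM i
  | succ d ih =>
    obtain hM | ⟨G, f, _, hG, hK⟩ := hM
    · exact of_refl hM i
    obtain ⟨i, rfl⟩ := Nat.exists_eq_add_of_le' (Nat.one_le_of_lt hi)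
    have hS : (ShortComplex.mk (Limits.kernel.ι f) f (by simp)).ShortExact :=
      { exact := ShortComplex.exact_kernel f }
    exact hS.subsingleton_ext_X₃ _ (i + 1) (ih _ hK i (by omega)) (of_refl hG (i + 1))

variable [IsNoetherianRing R]

lemma subsingleton_ext_dual (n : ℕ) [HasInjectiveDimensionLE (ModuleCat.of R R) n] (j : ℕ)
    (G : Type) [AddCommGroup G] [Module R G] [Module.Finite R G]
    (hG : ∀ i, Subsingleton (Abelian.Ext.{0} (ModuleCat.of R G) (ModuleCat.of R R) (i + 1)))
    (i : ℕ) (hi : n ≤ i + j) :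
    Subsingleton (Abelian.Ext.{0} (ModuleCat.of R (Module.Dual R G)) (ModuleCat.of R R)
      (i + 1)) := by
  induction j generalizing G i with
  | zero => exact HasInjectiveDimensionLT.subsingleton _ (n + 1) _ (by omega) _
  | succ j ih =>
    obtain ⟨F, _, _, _, _, f, hf⟩ := Module.exists_finite_presentation R G
    exact (shortExact_dual_of_subsingleton_ext_one hf (hG 0)).subsingleton_ext_X₁ _ (i + 1)
      (Abelian.Ext.subsingleton_of_projective (ModuleCat.of R (Module.Dual R F)) _ i)
      (ih f.ker (fun i => subsingleton_ext_ker hf _ i (hG (i + 1))) (i + 1) (by omega))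

lemma surjective_dual_eval (n : ℕ) [HasInjectiveDimensionLE (ModuleCat.of R R) n]
    (G : Type) [AddCommGroup G] [Module R G] [Module.Finite R G]
    (hG : ∀ i, Subsingleton (Abelian.Ext.{0} (ModuleCat.of R G) (ModuleCat.of R R) (i + 1))) :
    Function.Surjective (Module.Dual.eval R G) := by
  obtain ⟨F, _, _, _, _, f, hf⟩ := Module.exists_finite_presentation R G
  intro ξ
  obtain ⟨ψ, hψ⟩ := (shortExact_dual_of_subsingleton_ext_one hf (hG 0)).exists_extension
    (ModuleCat.of R R) (subsingleton_ext_dual n n f.ker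
      (fun i => subsingleton_ext_ker hf _ i (hG (i + 1))) 0 (by omega)) (ModuleCat.ofHom ξ)
  obtain ⟨y, hy⟩ := (Module.bijective_dual_eval R F).2 ψ.hom
  refine ⟨f y, LinearMap.ext fun φ => ?_⟩
  have h₁ : ψ.hom (f.dualMap φ) = ξ φ := congr(ModuleCat.Hom.hom $hψ φ)
  rw [← h₁, ← hy]
  rfl

lemma injective_dual_eval (n : ℕ) [HasInjectiveDimensionLE (ModuleCat.of R R) n]
    (G : Type) [AddCommGroup G] [Module R G] [Module.Finite R G]
    (hG : ∀ i, Subsingleton (Abelian.Ext.{0} (ModuleCat.of R G) (ModuleCat.of R R) (i + 1))) :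
    Function.Injective (Module.Dual.eval R G) := by
  obtain ⟨F, _, _, _, _, f, hf⟩ := Module.exists_finite_presentation R G
  rw [injective_iff_map_eq_zero]
  intro g hg
  obtain ⟨y, rfl⟩ := hf g
  have hS := shortExact_dual_of_subsingleton_ext_one hf (hG 0)
  obtain ⟨η, hη⟩ : ∃ η : Module.Dual R (Module.Dual R f.ker),
      η ∘ₗ f.ker.subtype.dualMap = Module.Dual.eval R F y := by
    have := hS.epi_g
    have h₀ : ModuleCat.ofHom f.dualMap ≫ ModuleCat.ofHom (Module.Dual.eval R F y) = 0 := by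
      ext φ
      exact congr($hg φ)
    exact ⟨(hS.exact.desc _ h₀).hom, congr(ModuleCat.Hom.hom $(hS.exact.g_desc _ h₀))⟩
  obtain ⟨k, rfl⟩ := surjective_dual_eval n f.ker
    (fun i => subsingleton_ext_ker hf _ i (hG (i + 1))) η
  have hk : (k : F) = y := (Module.bijective_dual_eval R F).1 hη
  rw [← hk]
  exact k.2

lemma totallyReflexive_of_subsingleton_ext (n : ℕ)
    [HasInjectiveDimensionLE (ModuleCat.of R R) n] (G : ModuleCat.{0} R) [Module.Finite R G]
    (hG : ∀ i, Subsingleton (Abelian.Ext.{0} G (ModuleCat.of R R) (i + 1))) :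
    TotallyReflexive R G := by
  refine ⟨inferInstance, ⟨injective_dual_eval n G hG, surjective_dual_eval n G hG⟩, ?_⟩
  rintro (_ | i) hi
  · omega
  · rw [extVanish_succ_iff, extVanish_succ_iff]
    exact ⟨hG i, subsingleton_ext_dual n n G hG i (by omega)⟩

lemma gdimLE_of_subsingleton_ext (n : ℕ) [HasInjectiveDimensionLE (ModuleCat.of R R) n]
    (d : ℕ) (M : ModuleCat.{0} R) [Module.Finite R M]
    (hM : ∀ i, d ≤ i → Subsingleton (Abelian.Ext.{0} M (ModuleCat.of R R) (i + 1))) :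
    GdimLE R d M := by
  induction d generalizing M with
  | zero => exact totallyReflexive_of_subsingleton_ext n M fun i => hM i i.zero_le
  | succ d ih =>
    obtain ⟨F, _, _, _, _, f, hf⟩ := Module.exists_finite_presentation R M
    let e : Limits.kernel (ModuleCat.ofHom f) ≅ ModuleCat.of R f.ker :=
      ModuleCat.kernelIsoKer (ModuleCat.ofHom f)
    have : Module.Finite R (Limits.kernel (ModuleCat.ofHom f) : ModuleCat.{0} R) :=
      Module.Finite.equiv e.toLinearEquiv.symm
    refine Or.inr ⟨ModuleCat.of R F, ModuleCat.ofHom f, (ModuleCat.epi_iff_surjective _).2 hf,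
      totallyReflexive_of_subsingleton_ext n _
        fun i => Abelian.Ext.subsingleton_of_projective _ _ i, ih _ fun i hi => ?_⟩
    rw [e.subsingleton_ext_iff]
    exact subsingleton_ext_ker hf _ i (hM (i + 1) (by omega))

end TotallyReflexive

theorem gorenstein_iff_every_fg_module_finite_Gdim
    (R : Type) [CommRing R] [IsNoetherianRing R] [IsLocalRing R] :
    IsGorensteinRing R ↔
      ∀ M : ModuleCat R, Module.Finite R M → ∃ n : ℕ, GdimLE R n M := by
  constructor
  · rintro ⟨n, hn⟩ M _
    have : HasInjectiveDimensionLE (ModuleCat.of R R) n :=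
      hasInjectiveDimensionLT_of_enoughProjectives _ _ fun N =>
        (extVanish_succ_iff R N _ n).1 (hn N (n + 1) n.lt_succ_self)
    exact ⟨n, gdimLE_of_subsingleton_ext n n M fun i hi =>
      HasInjectiveDimensionLT.subsingleton _ (n + 1) _ (by omega) _⟩
  · intro h
    obtain ⟨n, hn⟩ := h (ModuleCat.of R (R ⧸ IsLocalRing.maximalIdeal R)) inferInstance
    have : HasInjectiveDimensionLE (ModuleCat.of R R) n :=
      ModuleCat.hasInjectiveDimensionLE_of_residueField _ n fun i hi => by
        obtain ⟨i, rfl⟩ := Nat.exists_eq_add_of_le' (Nat.one_le_of_lt hi)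
        exact subsingleton_ext_of_gdimLE n _ hn i (by omega)
    refine ⟨n, fun N i hi => ?_⟩
    obtain ⟨i, rfl⟩ := Nat.exists_eq_add_of_le' (Nat.one_le_of_lt hi)
    exact (extVanish_succ_iff R N _ i).2
      (HasInjectiveDimensionLT.subsingleton _ (n + 1) _ (by omega) _)
end
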